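/- Let Φ be a Young function satisfying the Δ2-condition and let f : L_{Φ*} → ℝ be a (finite-valued) convex function. The following are equivalent: (1) f is τ(L_{Φ*},L_Φ)-continuous on L_{Φ*}; (2) f is sequentially τ(L_{Φ*},L_Φ)-continuous on L_{Φ*}; (3) f is sequentially τ(L_{Φ*},L_Φ)-continuous on each closed ball λB_{Φ*}, λ > 0; (4) f is sequentially τ(L_{Φ*},L_Φ)-continuous on each order interval [−ζ,ζ], 0 ≤ ζ ∈ L_{Φ*}; (5) f is order continuous: f(ξ_n) → f(ξ) whenever ξ_n → ξ a.s. and (ξ_n) is order bounded in L_{Φ*} (i.e. sup_n |ξ_n| ∈ L_{Φ*}). -/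

import Mathlib

open MeasureTheory Filter Topology Set
open scoped ENNReal

noncomputable section

namespace OrliczPaper

variable {Ω : Type*} [MeasurableSpace Ω]

/-- A (finite, coercive) Young function: an even convex function with `Φ 0 = 0`
and `Φ x / x → ∞` as `x → ∞`. -/
structure IsYoung (Φ : ℝ → ℝ) : Prop where
  even : ∀ x, Φ (-x) = Φ x
  convexOn : ConvexOn ℝ Set.univ Φ
  map_zero : Φ 0 = 0
  coercive : Tendsto (fun x => Φ x / x) atTop atTop

/-- The Δ₂-condition: `limsup_{x→∞} Φ(2x)/Φ(x) < ∞`, i.e. `Φ(2x) ≤ C Φ(x)`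
for all large `x`. -/
def Delta2 (Φ : ℝ → ℝ) : Prop :=
  ∃ C x₀ : ℝ, ∀ x ≥ x₀, Φ (2 * x) ≤ C * Φ x

/-- The conjugate Young function `Φ*(y) = sup_x (x y − Φ x)`. -/
def conj (Φ : ℝ → ℝ) (y : ℝ) : ℝ := ⨆ x : ℝ, x * y - Φ x

variable (P : Measure Ω)

/-- Membership in the Orlicz space `L_Φ`: a measurable function with
`E[Φ(l ξ)] < ∞` for some `l > 0`. -/
def MemOrlicz (Φ : ℝ → ℝ) (f : Ω → ℝ) : Prop :=
  Measurable f ∧ ∃ l : ℝ, 0 < l ∧ ∫⁻ ω, ENNReal.ofReal (Φ (l * f ω)) ∂P < ⊤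

/-- The Orlicz space `L_Φ`, as a set of (everywhere defined) measurable functions. -/
def Orlicz (Φ : ℝ → ℝ) : Set (Ω → ℝ) := {f | MemOrlicz P Φ f}

/-- The Luxemburg norm `‖f‖_Φ = inf {l > 0 : E[Φ(f/l)] ≤ 1}`. -/
def luxNorm (Φ : ℝ → ℝ) (f : Ω → ℝ) : ℝ :=
  sInf {l : ℝ | 0 < l ∧ ∫⁻ ω, ENNReal.ofReal (Φ (f ω / l)) ∂P ≤ 1}

/-- The Orlicz (dual) norm `‖f‖_{(Φ*)} = sup {E[g f] : E[Φ(g)] ≤ 1}`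
(the Young function `Φ` here is the one of the *predual*). -/
def orliczNorm (Φ : ℝ → ℝ) (f : Ω → ℝ) : ℝ :=
  sSup {r : ℝ | ∃ g : Ω → ℝ, Measurable g ∧
    (∫⁻ ω, ENNReal.ofReal (Φ (g ω)) ∂P) ≤ 1 ∧ r = ∫ ω, g ω * f ω ∂P}

/-- The bilinear pairing `⟨f, g⟩ = E[f g]`. -/
def pairing (f g : Ω → ℝ) : ℝ := ∫ ω, f ω * g ω ∂P

/-- The weak topology `σ(E, F)` on `E` induced by the pairing with `F`. -/
def weakT (E F : Set (Ω → ℝ)) : TopologicalSpace E :=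
  TopologicalSpace.induced
    (fun ξ : E => fun η : F => pairing P (ξ : Ω → ℝ) (η : Ω → ℝ)) inferInstance

/-- The absolutely convex (convex and balanced) `σ(F,E)`-compact subsets of `F`. -/
def dualSets (E F : Set (Ω → ℝ)) : Set (Set F) :=
  {A | Convex ℝ (Subtype.val '' A) ∧ Balanced ℝ (Subtype.val '' A) ∧
    @IsCompact _ (weakT P F E) A}

/-- The Mackey topology `τ(E, F)`: the topology on `E` of uniform convergence on
absolutely convex `σ(F,E)`-compact subsets of `F`. -/
def mackeyT (E F : Set (Ω → ℝ)) : TopologicalSpace E :=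
  TopologicalSpace.induced
    (fun ξ : E => UniformOnFun.ofFun (dualSets P E F)
      (fun η : F => pairing P (ξ : Ω → ℝ) (η : Ω → ℝ)))
    inferInstance

/-- A distance generating the topology of convergence in `P`-probability. -/
def probDist (f g : Ω → ℝ) : ℝ := ∫ ω, min |f ω - g ω| 1 ∂P

/-- The topology of convergence in probability, restricted to `E ⊆ L₀`. -/
def probT (E : Set (Ω → ℝ)) : TopologicalSpace E :=
  TopologicalSpace.generateFrom
    {U | ∃ f : E, ∃ ε : ℝ, 0 < ε ∧ U = {g : E | probDist P (f : Ω → ℝ) (g : Ω → ℝ) < ε}}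

/-- `L_∞`: essentially bounded measurable functions. -/
def Linf : Set (Ω → ℝ) := {f | Measurable f ∧ ∃ C : ℝ, ∀ᵐ ω ∂P, |f ω| ≤ C}

/-- `L_1`: integrable measurable functions. -/
def L1 : Set (Ω → ℝ) := {f | Measurable f ∧ Integrable f P}

/-- The essential supremum norm. -/
def linfNorm (f : Ω → ℝ) : ℝ := sInf {C : ℝ | 0 ≤ C ∧ ∀ᵐ ω ∂P, |f ω| ≤ C}

/-- Uniform integrability of a set of functions:
`sup_{f ∈ A} E[|f| 1_{|f| > N}] → 0`. -/
def UnifInt (A : Set (Ω → ℝ)) : Prop :=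
  Tendsto (fun N : ℕ => ⨆ f ∈ A, ∫⁻ ω in {ω | (N : ℝ) < |f ω|}, ENNReal.ofReal |f ω| ∂P)
    atTop (𝓝 0)

/-- Uniform integrability of a sequence of functions. -/
def UnifIntSeq (g : ℕ → Ω → ℝ) : Prop :=
  Tendsto (fun N : ℕ => ⨆ n, ∫⁻ ω in {ω | (N : ℝ) < |g n ω|}, ENNReal.ofReal |g n ω| ∂P)
    atTop (𝓝 0)

/-- The Cesàro means of a sequence of functions: `cesaro ξ N` is the average of
`ξ 0, …, ξ N`. -/
def cesaro (ξ : ℕ → Ω → ℝ) (N : ℕ) : Ω → ℝ :=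
  fun ω => (∑ i ∈ Finset.range (N + 1), ξ i ω) / (N + 1)

/-- `sup_n |ξ n| ∈ L_Φ` (order boundedness of the sequence `ξ` in `L_Φ`). -/
def supMem (Φ : ℝ → ℝ) (ξ : ℕ → Ω → ℝ) : Prop :=
  (∀ᵐ ω ∂P, BddAbove (Set.range fun n => |ξ n ω|)) ∧
    MemOrlicz P Φ (fun ω => ⨆ n, |ξ n ω|)

/-- `ξb` is a sequence of forward convex combinations of `ξ`:
`ξb n ∈ conv (ξ k ; k ≥ n)`. -/
def FwdConvComb (ξ ξb : ℕ → Ω → ℝ) : Prop :=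
  ∀ n, ξb n ∈ convexHull ℝ {g : Ω → ℝ | ∃ k ≥ n, g = ξ k}

/-- The left derivative of a convex function. -/
def leftDeriv (Φ : ℝ → ℝ) (y : ℝ) : ℝ :=
  ⨆ h : {h : ℝ // 0 < h}, (Φ y - Φ (y - (h : ℝ))) / (h : ℝ)

/-- `p_Φ(x) = sup_{y > x} y Φ'(y) / Φ(y)`. -/
def pPhiAt (Φ : ℝ → ℝ) (x : ℝ) : ℝ≥0∞ :=
  ⨆ y : {y : ℝ // x < y}, ENNReal.ofReal ((y : ℝ) * leftDeriv Φ (y : ℝ) / Φ (y : ℝ))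

/-- `p_Φ = inf_{x ≥ 0} p_Φ(x)`. -/
def pPhi (Φ : ℝ → ℝ) : ℝ≥0∞ := ⨅ x : {x : ℝ // 0 ≤ x}, pPhiAt Φ x

/-- `q_Φ = p_Φ / (p_Φ − 1)` (with `1/0 = ∞`). -/
def qPhi (Φ : ℝ → ℝ) : ℝ≥0∞ := pPhi Φ / (pPhi Φ - 1)

end OrliczPaper

namespace OrliczPaper

section Young

variable {Φ : ℝ → ℝ}

lemma IsYoung.map_midpoint_le (h : IsYoung Φ) (x y : ℝ) :
    Φ ((x + y) / 2) ≤ (Φ x + Φ y) / 2 := by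
  have hhalf : (0 : ℝ) ≤ 1 / 2 := by norm_num
  have := h.convexOn.2 (mem_univ x) (mem_univ y) hhalf hhalf (by norm_num)
  simp only [smul_eq_mul] at this
  have hxy : (x + y) / 2 = 1 / 2 * x + 1 / 2 * y := by ring
  rw [hxy]
  linarith

lemma IsYoung.nonneg (h : IsYoung Φ) (x : ℝ) : 0 ≤ Φ x := by
  have := h.map_midpoint_le x (-x)
  rw [h.even, add_neg_cancel, zero_div, h.map_zero] at this
  linarith

lemma IsYoung.map_mul_le (h : IsYoung Φ) {t : ℝ} (ht : 0 ≤ t) (ht1 : t ≤ 1) (x : ℝ) :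
    Φ (t * x) ≤ t * Φ x := by
  have := h.convexOn.2 (mem_univ x) (mem_univ 0) ht (sub_nonneg.2 ht1) (by ring)
  simpa [h.map_zero] using this

lemma IsYoung.map_abs (h : IsYoung Φ) (x : ℝ) : Φ |x| = Φ x := by
  rcases abs_choice x with hx | hx <;> rw [hx]
  exact h.even x

lemma IsYoung.mono (h : IsYoung Φ) {x y : ℝ} (hxy : |x| ≤ |y|) : Φ x ≤ Φ y := by
  rw [← h.map_abs x, ← h.map_abs y]
  rcases (abs_nonneg y).eq_or_lt with hy | hy
  · have hx : |x| = |y| := le_antisymm hxy (hy ▸ abs_nonneg x)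
    rw [hx]
  have ht : |x| / |y| ≤ 1 := div_le_one_of_le₀ hxy hy.le
  have := h.map_mul_le (by positivity) ht |y|
  rw [div_mul_cancel₀ _ hy.ne'] at this
  exact this.trans (mul_le_of_le_one_left (h.nonneg _) ht)

lemma IsYoung.measurable (h : IsYoung Φ) : Measurable Φ :=
  h.convexOn.locallyLipschitz.continuous.measurable

lemma IsYoung.measurable_ofReal_comp {α : Type*} [MeasurableSpace α] (h : IsYoung Φ) {f : α → ℝ}
    (hf : Measurable f) : Measurable fun ω => ENNReal.ofReal (Φ (f ω)) :=
  (h.measurable.comp hf).ennreal_ofReal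

lemma IsYoung.bddAbove_conj (h : IsYoung Φ) (y : ℝ) :
    BddAbove (range fun x : ℝ => x * y - Φ x) := by
  obtain ⟨X, hX⟩ := eventually_atTop.1 (h.coercive.eventually_ge_atTop |y|)
  refine ⟨max X 1 * |y|, ?_⟩
  rintro _ ⟨x, rfl⟩
  have h1 : x * y ≤ |x| * |y| := (le_abs_self _).trans (abs_mul x y).le
  rcases le_total |x| (max X 1) with hx | hx
  · have := mul_le_mul_of_nonneg_right hx (abs_nonneg y)
    simp only
    linarith [h.nonneg x]
  · have hx0 : 0 < |x| := lt_of_lt_of_le (by positivity) hx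
    have h2 := hX |x| ((le_max_left _ _).trans hx)
    rw [le_div_iff₀ hx0, h.map_abs] at h2
    have : 0 ≤ max X 1 * |y| := by positivity
    simp only
    linarith

lemma IsYoung.young_le (h : IsYoung Φ) (x y : ℝ) : x * y ≤ Φ x + conj Φ y := by
  have := le_ciSup (h.bddAbove_conj y) x
  unfold conj
  linarith

lemma IsYoung.conj (h : IsYoung Φ) : IsYoung (conj Φ) where
  even y := by
    unfold OrliczPaper.conj
    rw [← (Equiv.neg ℝ).iSup_comp]
    simp [h.even]
  convexOn := by
    refine ⟨convex_univ, fun y _ z _ a b ha hb hab => ciSup_le fun x => ?_⟩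
    have h1 := mul_le_mul_of_nonneg_left (h.young_le x y) ha
    have h2 := mul_le_mul_of_nonneg_left (h.young_le x z) hb
    have h3 : Φ x = a * Φ x + b * Φ x := by rw [← add_mul, hab, one_mul]
    simp only [smul_eq_mul]
    linarith
  map_zero := by
    refine le_antisymm (ciSup_le fun x => ?_) ?_
    · simpa using h.nonneg x
    · simpa [h.map_zero] using h.young_le 0 0
  coercive := by
    refine tendsto_atTop.2 fun N => ?_
    filter_upwards [eventually_ge_atTop (max 1 (Φ (N + 1)))] with y hy
    have hy1 : 1 ≤ y := (le_max_left _ _).trans hy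
    have hy2 : Φ (N + 1) ≤ y := (le_max_right _ _).trans hy
    rw [le_div_iff₀ (by linarith)]
    linarith [h.young_le (N + 1) y]

/-- The right derivative of a finite convex function on the line, a monotone choice of
subgradients. -/
def rightSlope (Φ : ℝ → ℝ) (x : ℝ) : ℝ := derivWithin Φ (Ioi x) x

lemma IsYoung.monotone_rightSlope (h : IsYoung Φ) : Monotone (rightSlope Φ) := by
  have := h.convexOn.monotoneOn_rightDeriv
  rw [interior_univ, monotoneOn_univ] at this
  exact this

lemma IsYoung.rightSlope_mul_sub_le (h : IsYoung Φ) (x z : ℝ) :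
    rightSlope Φ x * (z - x) ≤ Φ z - Φ x := by
  rcases lt_trichotomy x z with hz | rfl | hz
  · have := h.convexOn.rightDeriv_le_slope_of_mem_interior (x := x) (y := z) (by simp) (by simp) hz
    rw [slope_def_field, le_div_iff₀ (by linarith)] at this
    exact this
  · simp
  · have h1 := h.convexOn.slope_le_leftDeriv_of_mem_interior (x := z) (y := x) (by simp) (by simp) hz
    have h2 := h.convexOn.leftDeriv_le_rightDeriv_of_mem_interior (x := x) (by simp)
    have h3 := h1.trans h2
    rw [slope_def_field, div_le_iff₀ (by linarith)] at h3
    unfold rightSlope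
    linarith

lemma IsYoung.conj_rightSlope_le (h : IsYoung Φ) (x : ℝ) :
    Φ x + OrliczPaper.conj Φ (rightSlope Φ x) ≤ x * rightSlope Φ x := by
  have : OrliczPaper.conj Φ (rightSlope Φ x) ≤ x * rightSlope Φ x - Φ x :=
    ciSup_le fun z => by linarith [h.rightSlope_mul_sub_le x z]
  linarith

end Young

section Space

variable {Ω : Type*} [MeasurableSpace Ω] {P : Measure Ω} {Φ : ℝ → ℝ}

lemma MemOrlicz.of_abs_le (h : IsYoung Φ) {f g : Ω → ℝ} (hg : MemOrlicz P Φ g)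
    (hf : Measurable f) (hfg : ∀ᵐ ω ∂P, |f ω| ≤ |g ω|) : MemOrlicz P Φ f := by
  obtain ⟨-, l, hl, hl'⟩ := hg
  refine ⟨hf, l, hl, (lintegral_mono_ae ?_).trans_lt hl'⟩
  filter_upwards [hfg] with ω hω
  refine ENNReal.ofReal_le_ofReal (h.mono ?_)
  rw [abs_mul, abs_mul]
  gcongr

lemma MemOrlicz.const_smul (h : IsYoung Φ) {f : Ω → ℝ} (hf : MemOrlicz P Φ f) (c : ℝ) :
    MemOrlicz P Φ (c • f) := by
  obtain ⟨hm, l, hl, hl'⟩ := hf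
  refine ⟨hm.const_smul c, l / (|c| + 1), by positivity, (lintegral_mono fun ω => ?_).trans_lt hl'⟩
  refine ENNReal.ofReal_le_ofReal (h.mono ?_)
  simp only [Pi.smul_apply, smul_eq_mul, abs_mul, abs_div, abs_of_pos hl]
  rw [abs_of_pos (by positivity : 0 < |c| + 1), div_mul_eq_mul_div, div_le_iff₀ (by positivity)]
  nlinarith [abs_nonneg c, mul_nonneg hl.le (abs_nonneg (f ω))]

lemma MemOrlicz.add (h : IsYoung Φ) {f g : Ω → ℝ} (hf : MemOrlicz P Φ f)
    (hg : MemOrlicz P Φ g) : MemOrlicz P Φ (f + g) := by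
  obtain ⟨hfm, l, hl, hl'⟩ := hf
  obtain ⟨hgm, m, hm, hm'⟩ := hg
  set k := min l m with hk
  have hk0 : 0 < k := lt_min hl hm
  refine ⟨hfm.add hgm, k / 2, by positivity, ?_⟩
  refine lt_of_le_of_lt (b := ∫⁻ ω, (ENNReal.ofReal (Φ (l * f ω)) + ENNReal.ofReal (Φ (m * g ω))) ∂P)
    (lintegral_mono fun ω => ?_) ?_
  · rw [← ENNReal.ofReal_add (h.nonneg _) (h.nonneg _)]
    refine ENNReal.ofReal_le_ofReal ?_
    have h1 := h.map_midpoint_le (k * f ω) (k * g ω)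
    have h2 : Φ (k * f ω) ≤ Φ (l * f ω) := h.mono (by
      rw [abs_mul, abs_mul, abs_of_pos hk0, abs_of_pos hl]
      exact mul_le_mul_of_nonneg_right (min_le_left _ _) (abs_nonneg _))
    have h3 : Φ (k * g ω) ≤ Φ (m * g ω) := h.mono (by
      rw [abs_mul, abs_mul, abs_of_pos hk0, abs_of_pos hm]
      exact mul_le_mul_of_nonneg_right (min_le_right _ _) (abs_nonneg _))
    have h4 : k / 2 * (f + g) ω = (k * f ω + k * g ω) / 2 := by
      simp only [Pi.add_apply]; ring
    rw [h4]
    linarith [h.nonneg (l * f ω), h.nonneg (m * g ω)]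
  · rw [lintegral_add_left (h.measurable_ofReal_comp (hfm.const_mul l))]
    exact ENNReal.add_lt_top.2 ⟨hl', hm'⟩

lemma MemOrlicz.of_bounded [IsFiniteMeasure P] (h : IsYoung Φ) {f : Ω → ℝ} (hf : Measurable f)
    {C : ℝ} (hC : ∀ ω, |f ω| ≤ C) : MemOrlicz P Φ f := by
  refine ⟨hf, 1, one_pos, ?_⟩
  refine lt_of_le_of_lt (lintegral_mono fun ω => (?_ : _ ≤ ENNReal.ofReal (Φ C))) ?_
  · refine ENNReal.ofReal_le_ofReal (h.mono ?_)
    rw [one_mul]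
    exact (hC ω).trans (le_abs_self C)
  · rw [lintegral_const]
    exact ENNReal.mul_lt_top ENNReal.ofReal_lt_top (measure_lt_top _ _)

/-- The Orlicz space as a vector space. -/
def orliczSubmodule [IsFiniteMeasure P] (h : IsYoung Φ) : Submodule ℝ (Ω → ℝ) where
  carrier := Orlicz P Φ
  add_mem' hf hg := MemOrlicz.add h hf hg
  zero_mem' := MemOrlicz.of_bounded h measurable_const (C := 0) (by simp)
  smul_mem' c _ hf := MemOrlicz.const_smul h hf c

/-- Up to a scaling, every element of an Orlicz space lies in the unit ball. -/
lemma MemOrlicz.exists_lintegral_div_le_one (h : IsYoung Φ) {f : Ω → ℝ} (hf : MemOrlicz P Φ f) :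
    ∃ r : ℝ, 0 < r ∧ ∫⁻ ω, ENNReal.ofReal (Φ (f ω / r)) ∂P ≤ 1 := by
  obtain ⟨hm, l, hl, hl'⟩ := hf
  set I := ∫⁻ ω, ENNReal.ofReal (Φ (l * f ω)) ∂P with hI
  set M : ℝ := I.toReal + 1 with hM
  have hM1 : 1 ≤ M := by rw [hM]; linarith [ENNReal.toReal_nonneg (a := I)]
  have hM0 : 0 < M := by linarith
  refine ⟨M / l, by positivity, ?_⟩
  calc ∫⁻ ω, ENNReal.ofReal (Φ (f ω / (M / l))) ∂P
      ≤ ∫⁻ ω, ENNReal.ofReal M⁻¹ * ENNReal.ofReal (Φ (l * f ω)) ∂P := by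
        refine lintegral_mono fun ω => ?_
        rw [← ENNReal.ofReal_mul (by positivity)]
        refine ENNReal.ofReal_le_ofReal ?_
        have : f ω / (M / l) = M⁻¹ * (l * f ω) := by field_simp
        rw [this]
        exact h.map_mul_le (by positivity) (inv_le_one_of_one_le₀ hM1) _
    _ = ENNReal.ofReal M⁻¹ * I :=
        lintegral_const_mul _ (h.measurable_ofReal_comp (hm.const_mul l))
    _ ≤ ENNReal.ofReal M⁻¹ * ENNReal.ofReal M := by
        gcongr
        rw [ENNReal.le_ofReal_iff_toReal_le hl'.ne hM0.le]
        linarith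
    _ = 1 := by
        rw [← ENNReal.ofReal_mul (by positivity), inv_mul_cancel₀ hM0.ne', ENNReal.ofReal_one]

lemma MemOrlicz.integrable_mul (h : IsYoung Φ) {f g : Ω → ℝ} (hf : MemOrlicz P Φ f)
    (hg : MemOrlicz P (conj Φ) g) : Integrable (fun ω => f ω * g ω) P := by
  obtain ⟨hfm, l, hl, hl'⟩ := hf
  obtain ⟨hgm, m, hm, hm'⟩ := hg
  have key : Integrable (fun ω => (l * f ω) * (m * g ω)) P := by
    refine ⟨((hfm.const_mul l).mul (hgm.const_mul m)).aestronglyMeasurable, ?_⟩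
    refine lt_of_le_of_lt (b := ∫⁻ ω, (ENNReal.ofReal (Φ (l * f ω)) +
      ENNReal.ofReal (conj Φ (m * g ω))) ∂P) (lintegral_mono fun ω => ?_) ?_
    · rw [← ENNReal.ofReal_add (h.nonneg _) (h.conj.nonneg _), ← ofReal_norm]
      refine ENNReal.ofReal_le_ofReal ?_
      rw [Real.norm_eq_abs, abs_mul, ← h.map_abs, ← h.conj.map_abs (m * g ω)]
      exact h.young_le _ _
    · rw [lintegral_add_left (h.measurable_ofReal_comp (hfm.const_mul l))]
      exact ENNReal.add_lt_top.2 ⟨hl', hm'⟩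
  have := key.const_mul (l * m)⁻¹
  refine this.congr (ae_of_all _ fun ω => ?_)
  simp only
  field_simp

end Space

section Schur

/-- A Schur-type property: if all the subseries of `∑ a j` are continuous on a compact set `K`,
then `a j → 0` uniformly on `K`. -/
lemma eventually_forall_abs_lt_of_continuousOn_subseries {X : Type*} [TopologicalSpace X]
    {K : Set X} (hK : IsCompact K) (a : ℕ → X → ℝ)
    (hsum : ∀ η ∈ K, Summable fun j => |a j η|)
    (hcont : ∀ c : ℕ → Bool, ContinuousOn (fun η => ∑' j, if c j then a j η else 0) K)
    {ε : ℝ} (hε : 0 < ε) : ∀ᶠ j in atTop, ∀ η ∈ K, |a j η| < ε := by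
  set S : (ℕ → Bool) → X → ℝ := fun c η => ∑' j, if c j then a j η else 0 with hS
  have hSsum : ∀ c : ℕ → Bool, ∀ η ∈ K, Summable fun j => if c j then a j η else 0 := by
    intro c η hη
    refine Summable.of_norm_bounded (hsum η hη) fun j => ?_
    split_ifs <;> simp
  have hSdiff : ∀ (c : ℕ → Bool) (n : ℕ), ∀ η ∈ K,
      S (Function.update c n true) η - S (Function.update c n false) η = a n η := by
    intro c n η hη
    rw [hS]
    simp only
    rw [← (hSsum _ η hη).tsum_sub (hSsum _ η hη), tsum_eq_single n]
    · simp
    · intro j hj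
      simp [Function.update_of_ne hj]
  have hSc : ∀ η ∈ K, Continuous fun c => S c η := by
    intro η hη
    refine continuous_tsum (u := fun j => |a j η|) (fun j => ?_) (hsum η hη) fun j c => ?_
    · exact (continuous_of_discreteTopology (f := fun b : Bool => if b then a j η else 0)).comp
        (continuous_apply j)
    · split_ifs <;> simp
  have ha : ∀ j, ContinuousOn (a j) K := by
    intro j
    refine (((hcont (Function.update (fun _ => false) j true)).sub
      (hcont (Function.update (fun _ => false) j false)))).congr fun η hη => ?_
    exact (hSdiff _ j η hη).symm
  by_contra hcon
  rw [not_eventually] at hcon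
  obtain ⟨φ, hφ, hφ'⟩ := extraction_of_frequently_atTop hcon
  push Not at hφ'
  choose y hyK hy using hφ'
  have himg : IsCompact ((fun η j => a j η) '' K) :=
    hK.image_of_continuousOn (continuousOn_pi.2 ha)
  obtain ⟨_, ⟨η₀, hη₀, rfl⟩, ψ, hψ, hlim⟩ :=
    himg.tendsto_subseq (x := fun k j => a j (y k)) fun k => ⟨y k, hyK k, rfl⟩
  have hSlim : ∀ c, Tendsto (fun k => S c (y (ψ k))) atTop (𝓝 (S c η₀)) := by
    intro c
    refine tendsto_of_subseq_tendsto fun ns hns => ?_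
    have himg2 : IsCompact ((fun η => ((fun j => a j η : ℕ → ℝ), S c η)) '' K) :=
      hK.image_of_continuousOn ((continuousOn_pi.2 ha).prodMk (hcont c))
    obtain ⟨_, ⟨η₁, hη₁, rfl⟩, θ, hθ, hlim2⟩ :=
      himg2.tendsto_subseq (x := fun k => ((fun j => a j (y (ψ (ns k)))), S c (y (ψ (ns k)))))
        fun k => ⟨_, hyK _, rfl⟩
    refine ⟨θ, ?_⟩
    have h1 : (fun j => a j η₁) = fun j => a j η₀ :=
      tendsto_nhds_unique ((continuous_fst.tendsto _).comp hlim2)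
        (hlim.comp (hns.comp hθ.tendsto_atTop))
    have h2 : S c η₁ = S c η₀ := by
      simp only [hS]
      exact tsum_congr fun j => by rw [congrFun h1 j]
    rw [← h2]
    exact (continuous_snd.tendsto _).comp hlim2
  set F : ℕ → Set (ℕ → Bool) :=
    fun N => {c | ∀ k ≥ N, |S c (y (ψ k)) - S c η₀| ≤ ε / 8} with hF
  have hFc : ∀ N, IsClosed (F N) := by
    intro N
    have : F N = ⋂ k, ⋂ (_ : k ≥ N), {c | |S c (y (ψ k)) - S c η₀| ≤ ε / 8} := by
      ext c; simp [hF]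
    rw [this]
    exact isClosed_iInter fun k => isClosed_iInter fun _ =>
      isClosed_le (((hSc _ (hyK _)).sub (hSc _ hη₀)).abs) continuous_const
  have hFU : ⋃ N, F N = univ := by
    refine eq_univ_of_forall fun c => mem_iUnion.2 ?_
    obtain ⟨N, hN⟩ := Metric.tendsto_atTop.1 (hSlim c) (ε / 8) (by positivity)
    exact ⟨N, fun k hk => (hN k hk).le⟩
  obtain ⟨N, c₀, hc₀⟩ := nonempty_interior_of_iUnion_of_closed hFc hFU
  have hupd : ∀ b : Bool, Tendsto (fun k => Function.update c₀ (φ (ψ k)) b) atTop (𝓝 c₀) := by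
    intro b
    refine tendsto_pi_nhds.2 fun j => tendsto_const_nhds.congr' ?_
    filter_upwards [(hφ.comp hψ).tendsto_atTop.eventually_gt_atTop j] with k hk
    exact (Function.update_of_ne (ne_of_lt hk) _ _).symm
  have hev : ∀ b : Bool, ∀ᶠ k in atTop, Function.update c₀ (φ (ψ k)) b ∈ F N := fun b =>
    ((hupd b).eventually (isOpen_interior.mem_nhds hc₀)).mono fun _ h => interior_subset h
  have hsmall : ∀ᶠ k in atTop, |a (φ (ψ k)) η₀| < ε / 4 :=
    ((hsum η₀ hη₀).tendsto_atTop_zero.comp (hφ.comp hψ).tendsto_atTop).eventually_lt_const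
      (by positivity)
  obtain ⟨k, h1, h2, h3, hk⟩ :=
    ((hev true).and ((hev false).and (hsmall.and (eventually_ge_atTop N)))).exists
  have e1 := abs_le.1 (h1 k hk)
  have e2 := abs_le.1 (h2 k hk)
  have d1 := hSdiff c₀ (φ (ψ k)) (y (ψ k)) (hyK _)
  have d2 := hSdiff c₀ (φ (ψ k)) η₀ hη₀
  have e3 := abs_lt.1 h3
  have e4 := hy (ψ k)
  have : |a (φ (ψ k)) (y (ψ k))| < ε := abs_lt.2 ⟨by linarith, by linarith⟩
  linarith

end Schur

section Uniform

variable {Ω : Type*} [MeasurableSpace Ω] {P : Measure Ω} {Φ : ℝ → ℝ}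

lemma pairing_comm (f g : Ω → ℝ) : pairing P f g = pairing P g f := by
  simp only [pairing, mul_comm]

lemma continuous_pairing_weakT (E F : Set (Ω → ℝ)) (ξ : F) :
    @Continuous _ _ (weakT P E F) _ fun η : E => pairing P (η : Ω → ℝ) (ξ : Ω → ℝ) :=
  letI := weakT P E F
  (continuous_apply ξ).comp (continuous_induced_dom (f := fun η : E => fun ξ : F =>
    pairing P (η : Ω → ℝ) (ξ : Ω → ℝ)))

/-- A sequence with order bounded absolute partial sums pairs uniformly to zero on a weakly
compact set. -/
lemma eventually_abs_pairing_lt_of_sum_le (h : IsYoung Φ) {A : Set (Orlicz P Φ)}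
    (hA : @IsCompact _ (weakT P (Orlicz P Φ) (Orlicz P (conj Φ))) A)
    {ζ : Ω → ℝ} (hζ : MemOrlicz P (conj Φ) ζ) {x : ℕ → Ω → ℝ} (hx : ∀ n, Measurable (x n))
    (hxζ : ∀ n ω, ∑ k ∈ Finset.range n, |x k ω| ≤ ζ ω) {ε : ℝ} (hε : 0 < ε) :
    ∀ᶠ j in atTop, ∀ η ∈ A, |pairing P η.1 (x j)| < ε := by
  have hζ0 : ∀ ω, 0 ≤ ζ ω := fun ω => by simpa using hxζ 0 ω
  have hsumm : ∀ ω, Summable fun k => |x k ω| := fun ω =>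
    summable_of_sum_range_le (fun _ => abs_nonneg _) fun n => hxζ n ω
  have hmem : ∀ n, MemOrlicz P (conj Φ) (x n) := fun n =>
    hζ.of_abs_le h.conj (hx n) (ae_of_all _ fun ω => by
      rw [abs_of_nonneg (hζ0 ω)]
      refine le_trans ?_ (hxζ (n + 1) ω)
      exact Finset.single_le_sum (f := fun k => |x k ω|) (fun _ _ => abs_nonneg _)
        (Finset.self_mem_range_succ n))
  have hmul_int : ∀ (η : Orlicz P Φ) n, Integrable (fun ω => η.1 ω * x n ω) P := fun η n =>
    MemOrlicz.integrable_mul h η.2 (hmem n)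
  have hsumint : ∀ η : Orlicz P Φ, Summable fun n => ∫ ω, |η.1 ω * x n ω| ∂P := by
    intro η
    refine summable_of_sum_range_le (c := ∫ ω, |η.1 ω| * ζ ω ∂P)
      (fun _ => integral_nonneg fun _ => abs_nonneg _) fun n => ?_
    rw [← integral_finsetSum _ fun i _ => (hmul_int η i).abs]
    refine integral_mono (integrable_finsetSum _ fun i _ => (hmul_int η i).abs) ?_ fun ω => ?_
    · refine (MemOrlicz.integrable_mul h η.2 hζ).abs.congr (ae_of_all _ fun ω => ?_)
      simp only [abs_mul, abs_of_nonneg (hζ0 ω)]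
    · simp only [abs_mul, ← Finset.mul_sum]
      exact mul_le_mul_of_nonneg_left (hxζ n ω) (abs_nonneg _)
  have habs : ∀ η : Orlicz P Φ, Summable fun j => |pairing P η.1 (x j)| := fun η =>
    Summable.of_nonneg_of_le (fun _ => abs_nonneg _) (fun _ => abs_integral_le_integral_abs)
      (hsumint η)
  let xc : (ℕ → Bool) → Ω → ℝ := fun c ω => ∑' j, if c j then x j ω else 0
  have hxcs : ∀ (c : ℕ → Bool) ω, Summable fun j => |if c j then x j ω else 0| := fun c ω =>
    Summable.of_nonneg_of_le (fun _ => abs_nonneg _) (fun j => by split_ifs <;> simp) (hsumm ω)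
  have hxcm : ∀ c, Measurable (xc c) := by
    intro c
    refine measurable_of_tendsto_metrizable
      (f := fun n ω => ∑ j ∈ Finset.range n, if c j then x j ω else 0)
      (fun n => Finset.measurable_sum _ fun j _ => ?_)
      (tendsto_pi_nhds.2 fun ω => (hxcs c ω).of_abs.hasSum.tendsto_sum_nat)
    split_ifs
    exacts [hx j, measurable_const]
  have hxcmem : ∀ c, MemOrlicz P (conj Φ) (xc c) := fun c =>
    hζ.of_abs_le h.conj (hxcm c) (ae_of_all _ fun ω => by
      rw [abs_of_nonneg (hζ0 ω)]
      have h1 : ‖∑' j, if c j then x j ω else 0‖ ≤ ∑' j, ‖if c j then x j ω else 0‖ :=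
        norm_tsum_le_tsum_norm (hxcs c ω)
      have h2 : ∑' j, |if c j then x j ω else 0| ≤ ∑' j, |x j ω| :=
        Summable.tsum_le_tsum (fun j => by split_ifs <;> simp) (hxcs c ω) (hsumm ω)
      exact (h1.trans h2).trans
        (Real.tsum_le_of_sum_range_le (fun _ => abs_nonneg _) fun n => hxζ n ω))
  have hpair : ∀ (c : ℕ → Bool) (η : Orlicz P Φ),
      ∑' j, (if c j then pairing P η.1 (x j) else 0) = pairing P η.1 (xc c) := by
    intro c η
    have h1 : ∀ j, Integrable (fun ω => η.1 ω * if c j then x j ω else 0) P := fun j => by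
      by_cases hc : c j
      · simpa only [hc, if_true] using hmul_int η j
      · simp [hc]
    have h2 : Summable fun j => ∫ ω, ‖η.1 ω * if c j then x j ω else 0‖ ∂P := by
      refine Summable.of_nonneg_of_le (fun _ => integral_nonneg fun _ => norm_nonneg _)
        (fun j => ?_) (hsumint η)
      refine integral_mono (h1 j).norm (hmul_int η j).abs fun ω => ?_
      by_cases hc : c j <;> simp [hc]
      positivity
    have hs := hasSum_integral_of_summable_integral_norm h1 h2
    have e : pairing P η.1 (xc c) = ∫ ω, ∑' j, η.1 ω * (if c j then x j ω else 0) ∂P := by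
      simp only [pairing, xc, tsum_mul_left]
    rw [e, ← hs.tsum_eq]
    refine tsum_congr fun j => ?_
    split_ifs <;> simp [pairing]
  refine @eventually_forall_abs_lt_of_continuousOn_subseries _
    (weakT P (Orlicz P Φ) (Orlicz P (conj Φ))) A hA (fun j η => pairing P η.1 (x j))
    (fun η _ => habs η) (fun c => ?_) ε hε
  simp only [hpair]
  exact @Continuous.continuousOn _ _ (weakT P (Orlicz P Φ) (Orlicz P (conj Φ))) _ _ _
    (continuous_pairing_weakT (Orlicz P Φ) (Orlicz P (conj Φ)) ⟨xc c, hxcmem c⟩)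

end Uniform

section OrderConvergence

variable {Ω : Type*} [MeasurableSpace Ω] {P : Measure Ω} {Φ : ℝ → ℝ}

lemma eventually_abs_pairing_lt_of_forall (h : IsYoung Φ) {A : Set (Orlicz P Φ)}
    (hA : @IsCompact _ (weakT P (Orlicz P Φ) (Orlicz P (conj Φ))) A)
    {ζ : Ω → ℝ} (hζ : MemOrlicz P (conj Φ) ζ) {ξ : ℕ → Ω → ℝ} (hξ : ∀ n, Measurable (ξ n))
    (hξζ : ∀ n ω, |ξ n ω| ≤ ζ ω) (hlim : ∀ ω, Tendsto (fun n => ξ n ω) atTop (𝓝 0))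
    {ε : ℝ} (hε : 0 < ε) : ∀ᶠ j in atTop, ∀ η ∈ A, |pairing P η.1 (ξ j)| < ε := by
  set ρ : ℕ → Ω → ℝ := fun n ω => ⨆ j, |ξ (n + j) ω| with hρ
  have hbdd : ∀ n ω, BddAbove (range fun j => |ξ (n + j) ω|) := fun n ω =>
    ⟨ζ ω, by rintro _ ⟨j, rfl⟩; exact hξζ _ ω⟩
  have hρm : ∀ n, Measurable (ρ n) := fun n => Measurable.iSup fun j => (hξ (n + j)).abs
  have hρζ : ∀ n ω, ρ n ω ≤ ζ ω := fun n ω => ciSup_le fun j => hξζ _ ω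
  have hle : ∀ n m ω, n ≤ m → |ξ m ω| ≤ ρ n ω := fun n m ω hnm => by
    have := le_ciSup (hbdd n ω) (m - n)
    simpa only [Nat.add_sub_cancel' hnm] using this
  have hρanti : ∀ n m ω, n ≤ m → ρ m ω ≤ ρ n ω := fun n m ω hnm =>
    ciSup_le fun j => hle n (m + j) ω (by omega)
  have hρ0 : ∀ n ω, 0 ≤ ρ n ω := fun n ω => (abs_nonneg _).trans (hle n n ω le_rfl)
  have hζ0 : ∀ ω, 0 ≤ ζ ω := fun ω => (hρ0 0 ω).trans (hρζ 0 ω)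
  have hρlim : ∀ ω, Tendsto (fun n => ρ n ω) atTop (𝓝 0) := by
    intro ω
    refine Metric.tendsto_atTop.2 fun δ hδ => ?_
    obtain ⟨N, hN⟩ := Metric.tendsto_atTop.1 (hlim ω) (δ / 2) (by positivity)
    refine ⟨N, fun n hn => ?_⟩
    rw [Real.dist_eq, sub_zero, abs_of_nonneg (hρ0 n ω)]
    refine lt_of_le_of_lt (ciSup_le fun j => ?_) (half_lt_self hδ)
    have := hN (n + j) (by omega)
    rw [Real.dist_eq, sub_zero] at this
    exact this.le
  have hρmem : ∀ n, MemOrlicz P (conj Φ) (ρ n) := fun n =>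
    hζ.of_abs_le h.conj (hρm n) (ae_of_all _ fun ω => by
      rw [abs_of_nonneg (hρ0 n ω), abs_of_nonneg (hζ0 ω)]
      exact hρζ n ω)
  have hξmem : ∀ n, MemOrlicz P (conj Φ) (ξ n) := fun n =>
    hζ.of_abs_le h.conj (hξ n) (ae_of_all _ fun ω => (hξζ n ω).trans (le_abs_self _))
  have hρint : ∀ η : Orlicz P Φ, Tendsto (fun n => ∫ ω, |η.1 ω * ρ n ω| ∂P) atTop (𝓝 0) := by
    intro η
    have := tendsto_integral_of_dominated_convergence (μ := P)
      (F := fun n ω => |η.1 ω * ρ n ω|) (f := fun _ => (0 : ℝ)) (fun ω => |η.1 ω * ζ ω|)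
      (fun n => (MemOrlicz.integrable_mul h η.2 (hρmem n)).abs.aestronglyMeasurable)
      (MemOrlicz.integrable_mul h η.2 hζ).abs (fun n => ae_of_all _ fun ω => ?_)
      (ae_of_all _ fun ω => ?_)
    · simpa using this
    · rw [Real.norm_eq_abs, abs_abs, abs_mul, abs_mul, abs_of_nonneg (hρ0 n ω),
        abs_of_nonneg (hζ0 ω)]
      exact mul_le_mul_of_nonneg_left (hρζ n ω) (abs_nonneg _)
    · simpa using ((hρlim ω).const_mul (η.1 ω)).abs
  by_contra hcon
  rw [not_eventually, frequently_atTop] at hcon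
  push Not at hcon
  choose m hm η hη hηm using hcon
  have hnext : ∀ N, ∃ M, m N < M ∧ ∫ ω, |(η N).1 ω * ρ M ω| ∂P < ε / 2 := fun N =>
    ((eventually_gt_atTop (m N)).and
      ((hρint (η N)).eventually_lt_const (by positivity : (0 : ℝ) < ε / 2))).exists
  choose M hM hMint using hnext
  let N : ℕ → ℕ := fun k => M^[k] 0
  have hN : ∀ k, N (k + 1) = M (N k) := fun k => Function.iterate_succ_apply' M k 0
  set x : ℕ → Ω → ℝ := fun k ω =>
    ξ (m (N k)) ω - max (-ρ (N (k + 1)) ω) (min (ρ (N (k + 1)) ω) (ξ (m (N k)) ω)) with hx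
  have hxm : ∀ k, Measurable (x k) := fun k =>
    (hξ _).sub ((hρm _).neg.max ((hρm _).min (hξ _)))
  have hxle : ∀ k ω, |x k ω| ≤ ρ (N k) ω - ρ (N (k + 1)) ω := by
    intro k ω
    have h1 := abs_le.1 (hle (N k) (m (N k)) ω (hm _))
    have h2 : ρ (N (k + 1)) ω ≤ ρ (N k) ω := hρanti _ _ ω (by
      rw [hN]; exact (hm _).trans (hM _).le)
    have h3 := hρ0 (N (k + 1)) ω
    rw [abs_le]
    simp only [hx]
    constructor <;> rcases max_cases (-ρ (N (k + 1)) ω) (min (ρ (N (k + 1)) ω) (ξ (m (N k)) ω))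
      with ⟨e, _⟩ | ⟨e, _⟩ <;> rcases min_cases (ρ (N (k + 1)) ω) (ξ (m (N k)) ω)
      with ⟨e', _⟩ | ⟨e', _⟩ <;> rw [e] <;> linarith
  have hxsum : ∀ n ω, ∑ k ∈ Finset.range n, |x k ω| ≤ ζ ω := by
    intro n ω
    calc ∑ k ∈ Finset.range n, |x k ω|
        ≤ ∑ k ∈ Finset.range n, (ρ (N k) ω - ρ (N (k + 1)) ω) :=
          Finset.sum_le_sum fun k _ => hxle k ω
      _ = ρ (N 0) ω - ρ (N n) ω := Finset.sum_range_sub' (fun k => ρ (N k) ω) n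
      _ ≤ ζ ω := by linarith [hρζ (N 0) ω, hρ0 (N n) ω]
  obtain ⟨j, hj⟩ := (eventually_abs_pairing_lt_of_sum_le h hA hζ hxm hxsum (half_pos hε)).exists
  have hxmem : MemOrlicz P (conj Φ) (x j) := hζ.of_abs_le h.conj (hxm j) (ae_of_all _ fun ω => by
    rw [abs_of_nonneg (hζ0 ω)]
    linarith [hxle j ω, hρζ (N j) ω, hρ0 (N (j + 1)) ω])
  have hsub : |pairing P (η (N j)).1 (ξ (m (N j))) - pairing P (η (N j)).1 (x j)| < ε / 2 := by
    have i1 := MemOrlicz.integrable_mul h (η (N j)).2 (hξmem (m (N j)))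
    have i2 := MemOrlicz.integrable_mul h (η (N j)).2 hxmem
    unfold pairing
    rw [← integral_sub i1 i2]
    refine abs_integral_le_integral_abs.trans_lt (lt_of_le_of_lt ?_ (hMint (N j)))
    refine integral_mono (i1.sub i2).abs
      (MemOrlicz.integrable_mul h (η (N j)).2 (hρmem _)).abs fun ω => ?_
    simp only [← mul_sub, abs_mul]
    refine mul_le_mul_of_nonneg_left ?_ (abs_nonneg _)
    rw [← hN, abs_of_nonneg (hρ0 _ ω), hx, abs_le]
    simp only [sub_sub_cancel]
    exact ⟨le_max_left _ _, max_le (by linarith [hρ0 (N (j + 1)) ω]) (min_le_left _ _)⟩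
  have h1 := hj _ (hη (N j))
  have h2 := hηm (N j)
  have h3 := abs_sub_abs_le_abs_sub (pairing P (η (N j)).1 (ξ (m (N j))))
    (pairing P (η (N j)).1 (x j))
  linarith

/-- Order null sequences pair uniformly to zero on weakly compact sets. -/
lemma eventually_abs_pairing_lt (h : IsYoung Φ) {A : Set (Orlicz P Φ)}
    (hA : @IsCompact _ (weakT P (Orlicz P Φ) (Orlicz P (conj Φ))) A)
    {ζ : Ω → ℝ} (hζ : MemOrlicz P (conj Φ) ζ) {ξ : ℕ → Ω → ℝ} (hξ : ∀ n, Measurable (ξ n))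
    (hξζ : ∀ n, ∀ᵐ ω ∂P, |ξ n ω| ≤ ζ ω)
    (hlim : ∀ᵐ ω ∂P, Tendsto (fun n => ξ n ω) atTop (𝓝 0))
    {ε : ℝ} (hε : 0 < ε) : ∀ᶠ j in atTop, ∀ η ∈ A, |pairing P η.1 (ξ j)| < ε := by
  have hgood : ∀ᵐ ω ∂P, (∀ n, |ξ n ω| ≤ ζ ω) ∧ Tendsto (fun n => ξ n ω) atTop (𝓝 0) :=
    (ae_all_iff.2 hξζ).and hlim
  set S : Set Ω := (toMeasurable P {ω | ¬ ((∀ n, |ξ n ω| ≤ ζ ω) ∧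
    Tendsto (fun n => ξ n ω) atTop (𝓝 0))})ᶜ with hS
  have hSm : MeasurableSet S := (measurableSet_toMeasurable _ _).compl
  have hSae : ∀ᵐ ω ∂P, ω ∈ S := by
    rw [ae_iff]
    simp only [hS, mem_compl_iff, not_not, ofPred_mem_eq, measure_toMeasurable]
    exact ae_iff.1 hgood
  have hSgood : ∀ ω ∈ S, (∀ n, |ξ n ω| ≤ ζ ω) ∧ Tendsto (fun n => ξ n ω) atTop (𝓝 0) := by
    intro ω hω
    by_contra hc
    exact hω (subset_toMeasurable _ _ hc)
  have hζ' : MemOrlicz P (conj Φ) (S.indicator ζ) :=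
    hζ.of_abs_le h.conj (hζ.1.indicator hSm) (ae_of_all _ fun ω => by
      by_cases hω : ω ∈ S <;> simp [hω])
  refine (eventually_abs_pairing_lt_of_forall h hA hζ' (ξ := fun n => S.indicator (ξ n))
    (fun n => (hξ n).indicator hSm) (fun n ω => ?_) (fun ω => ?_) hε).mono fun j hj η hη => ?_
  · by_cases hω : ω ∈ S
    · simpa [hω] using (hSgood ω hω).1 n
    · simp [hω]
  · by_cases hω : ω ∈ S
    · simpa [hω] using (hSgood ω hω).2
    · simp [hω]
  · have e : pairing P η.1 (ξ j) = pairing P η.1 (S.indicator (ξ j)) := by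
      refine integral_congr_ae ?_
      filter_upwards [hSae] with ω hω
      simp [hω]
    rw [e]
    exact hj η hη

lemma pairing_sub_left (h : IsYoung Φ) {ξ ξ' η : Ω → ℝ} (hξ : MemOrlicz P (conj Φ) ξ)
    (hξ' : MemOrlicz P (conj Φ) ξ') (hη : MemOrlicz P Φ η) :
    pairing P (ξ - ξ') η = pairing P ξ η - pairing P ξ' η := by
  have i1 := MemOrlicz.integrable_mul h hη hξ
  have i2 := MemOrlicz.integrable_mul h hη hξ'
  simp only [mul_comm (η _)] at i1 i2
  unfold pairing
  rw [← integral_sub i1 i2]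
  simp only [Pi.sub_apply, sub_mul]

lemma tendsto_mackeyT_iff {ι : Type*} {l : Filter ι} {E F : Set (Ω → ℝ)} {ξ : ι → E} {ξ₀ : E} :
    Tendsto ξ l (@nhds _ (mackeyT P E F) ξ₀) ↔ ∀ A ∈ dualSets P E F, ∀ ε > 0,
      ∀ᶠ i in l, ∀ η ∈ A, |pairing P ξ₀.1 η.1 - pairing P (ξ i).1 η.1| < ε := by
  rw [mackeyT, nhds_induced, tendsto_comap_iff, UniformOnFun.tendsto_iff_tendstoUniformlyOn]
  simp only [Metric.tendstoUniformlyOn_iff, Real.dist_eq]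
  rfl

/-- Order convergence implies convergence in the Mackey topology. -/
lemma tendsto_mackeyT_of_order [IsFiniteMeasure P] (h : IsYoung Φ)
    {ζ : Ω → ℝ} (hζ : MemOrlicz P (conj Φ) ζ) {ξ : ℕ → Orlicz P (conj Φ)}
    {ξ₀ : Orlicz P (conj Φ)}
    (hξζ : ∀ n, ∀ᵐ ω ∂P, |(ξ n).1 ω| ≤ ζ ω)
    (hlim : ∀ᵐ ω ∂P, Tendsto (fun n => (ξ n).1 ω) atTop (𝓝 (ξ₀.1 ω))) :
    Tendsto ξ atTop (@nhds _ (mackeyT P (Orlicz P (conj Φ)) (Orlicz P Φ)) ξ₀) := by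
  rw [tendsto_mackeyT_iff]
  intro A hA ε hε
  have hξ₀ζ : ∀ᵐ ω ∂P, |ξ₀.1 ω| ≤ ζ ω := by
    filter_upwards [ae_all_iff.2 hξζ, hlim] with ω h1 h2
    exact le_of_tendsto h2.abs (Eventually.of_forall h1)
  refine (eventually_abs_pairing_lt h hA.2.2 (MemOrlicz.const_smul h.conj hζ 2)
    (ξ := fun n => ξ₀.1 - (ξ n).1) (fun n => ξ₀.2.1.sub (ξ n).2.1) (fun n => ?_) ?_ hε).mono
    fun n hn η hη => ?_
  · filter_upwards [hξζ n, hξ₀ζ] with ω h1 h2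
    simp only [Pi.sub_apply, Pi.smul_apply, smul_eq_mul]
    linarith [abs_sub (ξ₀.1 ω) ((ξ n).1 ω)]
  · filter_upwards [hlim] with ω hω
    simpa using (tendsto_const_nhds (x := ξ₀.1 ω)).sub hω
  · rw [← pairing_sub_left h ξ₀.2 (ξ n).2 η.2, pairing_comm]
    exact hn η hη

end OrderConvergence

section Representation

variable {Ω : Type*} [MeasurableSpace Ω] {P : Measure Ω} {Φ : ℝ → ℝ}

/-- An order bounded sequence in `L_Φ` that converges to zero almost surely. -/
def OrderNull (P : Measure Ω) (Φ : ℝ → ℝ) (ξ : ℕ → Ω → ℝ) : Prop :=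
  ∃ ζ, MemOrlicz P Φ ζ ∧ (∀ n, ∀ᵐ ω ∂P, |ξ n ω| ≤ ζ ω) ∧
    ∀ᵐ ω ∂P, Tendsto (fun n => ξ n ω) atTop (𝓝 0)

/-- A function with infinite modular admits a test function in the conjugate unit ball. -/
lemma IsYoung.exists_one_le_integral_mul [IsFiniteMeasure P] (h : IsYoung Φ) {u : Ω → ℝ}
    (hu : Measurable u) (htop : ∫⁻ ω, ENNReal.ofReal (Φ (u ω)) ∂P = ⊤) :
    ∃ g : Ω → ℝ, Measurable g ∧ (∃ C, ∀ ω, |g ω| ≤ C) ∧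
      ∫⁻ ω, ENNReal.ofReal (OrliczPaper.conj Φ (g ω)) ∂P ≤ 1 ∧ 1 ≤ ∫ ω, u ω * g ω ∂P := by
  let T : ℕ → Set Ω := fun m => {ω | |u ω| ≤ m}
  have hT : ∀ m, MeasurableSet (T m) := fun m => measurableSet_le hu.abs measurable_const
  have hmono : Tendsto (fun m => ∫⁻ ω, ENNReal.ofReal (Φ ((T m).indicator u ω)) ∂P) atTop
      (𝓝 (∫⁻ ω, ENNReal.ofReal (Φ (u ω)) ∂P)) := by
    refine lintegral_tendsto_of_tendsto_of_monotone
      (fun m => (h.measurable_ofReal_comp (hu.indicator (hT m))).aemeasurable)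
      (ae_of_all _ fun ω m n hmn => ENNReal.ofReal_le_ofReal (h.mono ?_))
      (ae_of_all _ fun ω => tendsto_const_nhds.congr' ?_)
    · by_cases hω : ω ∈ T m
      · have hω' : ω ∈ T n := le_trans (show |u ω| ≤ m from hω) (by exact_mod_cast hmn)
        rw [indicator_of_mem hω, indicator_of_mem hω']
      · simp [hω]
    · filter_upwards [eventually_ge_atTop ⌈|u ω|⌉₊] with m hm
      have hω : ω ∈ T m := Nat.ceil_le.1 hm
      rw [indicator_of_mem hω]
  rw [htop] at hmono
  obtain ⟨m, hm⟩ := (hmono.eventually_const_le ENNReal.one_lt_top).exists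
  set v := (T m).indicator u with hv
  set g := (T m).indicator (fun ω => rightSlope Φ (u ω)) with hg
  have hvm : Measurable v := hu.indicator (hT m)
  have hgm : Measurable g := (h.monotone_rightSlope.measurable.comp hu).indicator (hT m)
  have hvb : ∀ ω, |v ω| ≤ m := fun ω => by
    by_cases hω : ω ∈ T m
    · rw [hv, indicator_of_mem hω]; exact hω
    · rw [hv, indicator_of_notMem hω]; simp
  obtain ⟨C, hC⟩ : ∃ C, ∀ ω, |g ω| ≤ C := by
    refine ⟨max |rightSlope Φ (-m)| |rightSlope Φ m|, fun ω => ?_⟩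
    by_cases hω : ω ∈ T m
    · rw [hg, indicator_of_mem hω]
      have := abs_le.1 (show |u ω| ≤ m from hω)
      exact abs_le_max_abs_abs (h.monotone_rightSlope this.1) (h.monotone_rightSlope this.2)
    · rw [hg, indicator_of_notMem hω]; simp
  have hmul_int : ∀ {Q : ℝ → ℝ} (hQ : IsYoung Q) {w : Ω → ℝ} (hw : Measurable w) {D : ℝ}
      (hD : ∀ ω, |w ω| ≤ D), Integrable (fun ω => Q (w ω)) P := by
    intro Q hQ w hw D hD
    refine Integrable.of_bound (hQ.measurable.comp hw).aestronglyMeasurable (Q D)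
      (ae_of_all _ fun ω => ?_)
    rw [Real.norm_eq_abs, abs_of_nonneg (hQ.nonneg _)]
    exact hQ.mono ((hD ω).trans (le_abs_self D))
  have hiv := hmul_int h hvm hvb
  have hig := hmul_int h.conj hgm hC
  have hvg : Integrable (fun ω => v ω * g ω) P :=
    Integrable.of_bound (hvm.mul hgm).aestronglyMeasurable (m * C) (ae_of_all _ fun ω => by
      rw [Real.norm_eq_abs, abs_mul]
      exact mul_le_mul (hvb ω) (hC ω) (abs_nonneg _) (Nat.cast_nonneg m))
  have huv : ∀ ω, u ω * g ω = v ω * g ω := fun ω => by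
    by_cases hω : ω ∈ T m
    · rw [hv, indicator_of_mem hω]
    · simp [hg, indicator_of_notMem hω]
  have hpt : ∀ ω, Φ (v ω) + OrliczPaper.conj Φ (g ω) ≤ v ω * g ω := fun ω => by
    by_cases hω : ω ∈ T m
    · rw [hv, hg, indicator_of_mem hω, indicator_of_mem hω]
      exact h.conj_rightSlope_le _
    · simp [hv, hg, indicator_of_notMem hω, h.map_zero, h.conj.map_zero]
  set b := ∫ ω, OrliczPaper.conj Φ (g ω) ∂P with hb
  have hb0 : 0 ≤ b := integral_nonneg fun ω => h.conj.nonneg _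
  have ha : 1 ≤ ∫ ω, Φ (v ω) ∂P := by
    rw [← ofReal_integral_eq_lintegral_ofReal hiv (ae_of_all _ fun ω => h.nonneg _)] at hm
    exact ENNReal.one_le_ofReal.1 hm
  have hab : (∫ ω, Φ (v ω) ∂P) + b ≤ ∫ ω, v ω * g ω ∂P := by
    rw [hb, ← integral_add hiv hig]
    exact integral_mono (hiv.add hig) hvg hpt
  have hb1 : 0 < 1 + b := by linarith
  refine ⟨fun ω => (1 + b)⁻¹ * g ω, hgm.const_mul _, ⟨(1 + b)⁻¹ * C, fun ω => ?_⟩, ?_, ?_⟩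
  · rw [abs_mul, abs_of_pos (inv_pos.2 hb1)]
    exact mul_le_mul_of_nonneg_left (hC ω) (inv_nonneg.2 hb1.le)
  · have hinv1 : (1 + b)⁻¹ ≤ 1 := inv_le_one_of_one_le₀ (by linarith)
    calc ∫⁻ ω, ENNReal.ofReal (OrliczPaper.conj Φ ((1 + b)⁻¹ * g ω)) ∂P
        ≤ ∫⁻ ω, ENNReal.ofReal ((1 + b)⁻¹ * OrliczPaper.conj Φ (g ω)) ∂P :=
          lintegral_mono fun ω => ENNReal.ofReal_le_ofReal
            (h.conj.map_mul_le (inv_nonneg.2 hb1.le) hinv1 _)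
      _ = ENNReal.ofReal ((1 + b)⁻¹ * b) := by
          rw [← ofReal_integral_eq_lintegral_ofReal (hig.const_mul _) (ae_of_all _ fun ω =>
            mul_nonneg (inv_nonneg.2 hb1.le) (h.conj.nonneg _)), integral_const_mul]
      _ ≤ 1 := by
          rw [← ENNReal.ofReal_one]
          refine ENNReal.ofReal_le_ofReal ?_
          rw [inv_mul_le_iff₀ hb1]
          linarith
  · have e : ∀ ω, u ω * ((1 + b)⁻¹ * g ω) = (1 + b)⁻¹ * (v ω * g ω) := fun ω => by
      rw [← huv]; ring
    simp only [e]
    rw [integral_const_mul, inv_mul_eq_div, one_le_div hb1]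
    linarith

/-- Geometric multiples of elements of the unit ball form an order null sequence. -/
lemma IsYoung.orderNull_of_lintegral_le_one (h : IsYoung Φ)
    {ξ : ℕ → Ω → ℝ} (hξ : ∀ n, Measurable (ξ n))
    (hle : ∀ n, ∫⁻ ω, ENNReal.ofReal (Φ (ξ n ω)) ∂P ≤ 1) :
    OrderNull P Φ fun n => ((1 / 4 : ℝ) ^ n) • ξ n := by
  have hfin : ∫⁻ ω, ∑' n, ENNReal.ofReal (Φ ((1 / 2) ^ n * ξ n ω)) ∂P ≠ ⊤ := by
    rw [lintegral_tsum fun n =>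
      (h.measurable_ofReal_comp ((hξ n).const_mul _)).aemeasurable]
    refine ne_top_of_le_ne_top (b := ∑' n : ℕ, ENNReal.ofReal ((1 / 2) ^ n)) ?_
      (ENNReal.tsum_le_tsum fun n => ?_)
    · exact summable_geometric_two.tsum_ofReal_ne_top
    · calc ∫⁻ ω, ENNReal.ofReal (Φ ((1 / 2) ^ n * ξ n ω)) ∂P
          ≤ ∫⁻ ω, ENNReal.ofReal ((1 / 2) ^ n) * ENNReal.ofReal (Φ (ξ n ω)) ∂P := by
            refine lintegral_mono fun ω => ?_
            rw [← ENNReal.ofReal_mul (by positivity)]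
            exact ENNReal.ofReal_le_ofReal (h.map_mul_le (by positivity)
              (pow_le_one₀ (by norm_num) (by norm_num)) _)
        _ = ENNReal.ofReal ((1 / 2) ^ n) * ∫⁻ ω, ENNReal.ofReal (Φ (ξ n ω)) ∂P :=
            lintegral_const_mul _ (h.measurable_ofReal_comp (hξ n))
        _ ≤ ENNReal.ofReal ((1 / 2) ^ n) := mul_le_of_le_one_right' (hle n)
  have hmeas : Measurable fun ω => ∑' n, ENNReal.ofReal (Φ ((1 / 2) ^ n * ξ n ω)) :=
    Measurable.tsum fun n => h.measurable_ofReal_comp ((hξ n).const_mul _)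
  obtain ⟨X, hX⟩ := eventually_atTop.1 (h.coercive.eventually_ge_atTop 1)
  have hbdd : ∀ᵐ ω ∂P, BddAbove (range fun n => |(1 / 2) ^ n * ξ n ω|) ∧
      ENNReal.ofReal (Φ (⨆ n, |(1 / 2) ^ n * ξ n ω|)) ≤
        ∑' n, ENNReal.ofReal (Φ ((1 / 2) ^ n * ξ n ω)) := by
    filter_upwards [ae_lt_top hmeas hfin] with ω hω
    set t := ∑' n, ENNReal.ofReal (Φ ((1 / 2) ^ n * ξ n ω)) with ht
    have hΦt : ∀ n, Φ |(1 / 2) ^ n * ξ n ω| ≤ t.toReal := fun n => by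
      rw [h.map_abs]
      exact (ENNReal.ofReal_le_iff_le_toReal hω.ne).1 (ENNReal.le_tsum n)
    have hb : BddAbove (range fun n => |(1 / 2) ^ n * ξ n ω|) := by
      refine ⟨max (max X 1) t.toReal, ?_⟩
      rintro _ ⟨n, rfl⟩
      rcases le_total (max X 1) |(1 / 2) ^ n * ξ n ω| with hc | hc
      · have h1 := hX _ ((le_max_left _ _).trans hc)
        rw [one_le_div (lt_of_lt_of_le one_pos ((le_max_right _ _).trans hc))] at h1
        exact (h1.trans (hΦt n)).trans (le_max_right _ _)
      · exact hc.trans (le_max_left _ _)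
    refine ⟨hb, ?_⟩
    rw [ENNReal.ofReal_le_iff_le_toReal hω.ne]
    obtain ⟨s, -, hs, hs'⟩ := exists_seq_tendsto_sSup (range_nonempty _) hb
    refine le_of_tendsto ((h.convexOn.locallyLipschitz.continuous.tendsto _).comp hs)
      (Eventually.of_forall fun k => ?_)
    obtain ⟨n, hn⟩ := hs' k
    simp only [Function.comp_apply, ← hn]
    exact hΦt n
  refine ⟨fun ω => ⨆ n, |(1 / 2) ^ n * ξ n ω|, ⟨?_, 1, one_pos, ?_⟩, fun n => ?_, ?_⟩
  · exact Measurable.iSup fun n => ((hξ n).const_mul _).abs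
  · refine lt_of_le_of_lt (lintegral_mono_ae ?_) (lt_top_iff_ne_top.2 hfin)
    filter_upwards [hbdd] with ω hω
    rw [one_mul]
    exact hω.2
  · filter_upwards [hbdd] with ω hω
    refine le_trans ?_ (le_ciSup hω.1 n)
    simp only [Pi.smul_apply, smul_eq_mul, abs_mul, abs_pow]
    gcongr
    norm_num
  · filter_upwards [hbdd] with ω hω
    refine squeeze_zero_norm (a := fun n => (1 / 2 : ℝ) ^ n * ⨆ n, |(1 / 2) ^ n * ξ n ω|)
      (fun n => ?_) ?_
    · have e : ((1 / 4 : ℝ) ^ n • ξ n) ω = (1 / 2) ^ n * ((1 / 2) ^ n * ξ n ω) := by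
        rw [Pi.smul_apply, smul_eq_mul, ← mul_assoc, ← mul_pow]; norm_num
      rw [e, Real.norm_eq_abs, abs_mul, abs_of_pos (by positivity)]
      exact mul_le_mul_of_nonneg_left (le_ciSup hω.1 n) (by positivity)
    · simpa using (tendsto_pow_atTop_nhds_zero_of_lt_one (by norm_num : (0 : ℝ) ≤ 1 / 2)
        (by norm_num)).mul_const (⨆ n, |(1 / 2) ^ n * ξ n ω|)

end Representation

section OrderDual

variable {Ω : Type*} [MeasurableSpace Ω] {P : Measure Ω} [IsFiniteMeasure P] {Φ : ℝ → ℝ}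

/-- A linear functional on the Orlicz space that maps order null sequences to null sequences. -/
def OrderContinuousFunctional (h : IsYoung Φ) (L : orliczSubmodule (P := P) h →ₗ[ℝ] ℝ) : Prop :=
  ∀ ξ : ℕ → orliczSubmodule (P := P) h, OrderNull P Φ (fun n => (ξ n).1) →
    Tendsto (fun n => L (ξ n)) atTop (𝓝 0)

variable {h : IsYoung Φ} {L : orliczSubmodule (P := P) h →ₗ[ℝ] ℝ}

lemma OrderContinuousFunctional.map_eq_zero (hL : OrderContinuousFunctional h L)
    {ξ : orliczSubmodule (P := P) h} (hξ : ∀ᵐ ω ∂P, ξ.1 ω = 0) : L ξ = 0 := by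
  refine tendsto_nhds_unique tendsto_const_nhds (hL (fun _ => ξ) ⟨fun _ => 0, ?_, ?_, ?_⟩)
  · exact MemOrlicz.of_bounded h measurable_const (C := 0) (by simp)
  · exact fun _ => hξ.mono fun ω hω => by simp [hω]
  · exact hξ.mono fun ω hω => by simp [hω]

lemma OrderContinuousFunctional.tendsto (hL : OrderContinuousFunctional h L)
    {ξ : ℕ → orliczSubmodule (P := P) h} {ξ₀ : orliczSubmodule (P := P) h} {ζ : Ω → ℝ}
    (hζ : MemOrlicz P Φ ζ) (hξζ : ∀ n ω, |(ξ n).1 ω| ≤ ζ ω)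
    (hlim : ∀ ω, Tendsto (fun n => (ξ n).1 ω) atTop (𝓝 (ξ₀.1 ω))) :
    Tendsto (fun n => L (ξ n)) atTop (𝓝 (L ξ₀)) := by
  have hξ₀ζ : ∀ ω, |ξ₀.1 ω| ≤ ζ ω := fun ω =>
    le_of_tendsto (hlim ω).abs (Eventually.of_forall fun n => hξζ n ω)
  have := hL (fun n => ξ n - ξ₀) ⟨(2 : ℝ) • ζ, MemOrlicz.const_smul h hζ 2,
    fun n => ae_of_all _ fun ω => ?_, ae_of_all _ fun ω => ?_⟩
  · simp only [map_sub] at this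
    simpa using this.add_const (L ξ₀)
  · simp only [Submodule.coe_sub, Pi.sub_apply, Pi.smul_apply, smul_eq_mul]
    linarith [abs_sub ((ξ n).1 ω) (ξ₀.1 ω), hξζ n ω, hξ₀ζ ω]
  · simpa using (hlim ω).sub_const (ξ₀.1 ω)

lemma memOrlicz_indicator_one (h : IsYoung Φ) {B : Set Ω} (hB : MeasurableSet B) :
    MemOrlicz P Φ (B.indicator fun _ => (1 : ℝ)) :=
  MemOrlicz.of_bounded h (measurable_const.indicator hB) (C := 1) fun ω => by
    by_cases hω : ω ∈ B <;> simp [hω]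

open Classical in
/-- The signed measure `B ↦ L 1_B`. -/
def OrderContinuousFunctional.signedMeasure (hL : OrderContinuousFunctional h L) :
    SignedMeasure Ω where
  measureOf' B := if hB : MeasurableSet B then L ⟨_, memOrlicz_indicator_one h hB⟩ else 0
  empty' := by
    rw [dif_pos MeasurableSet.empty]
    exact hL.map_eq_zero (ae_of_all _ fun ω => by simp)
  not_measurable' B hB := dif_neg hB
  m_iUnion' B hB hdisj := by
    have hU : MeasurableSet (⋃ i, B i) := MeasurableSet.iUnion hB
    simp only [dif_pos hU, dif_pos (hB _)]
    rw [HasSum, SummationFilter.unconditional_filter]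
    refine tendsto_of_seq_tendsto fun s hs => ?_
    have hone : MemOrlicz P Φ fun _ => (1 : ℝ) :=
      MemOrlicz.of_bounded h measurable_const (C := 1) (by simp)
    have hsum : ∀ n ω, (∑ i ∈ s n, (⟨_, memOrlicz_indicator_one h (hB i)⟩ :
        orliczSubmodule (P := P) h)).1 ω = (⋃ i ∈ s n, B i).indicator (fun _ => (1 : ℝ)) ω := by
      intro n ω
      rw [Finset.indicator_biUnion_apply (s n) B fun i _ j _ hij => hdisj hij]
      rw [Submodule.coe_sum, Finset.sum_apply]
    have := hL.tendsto (ξ := fun n => ∑ i ∈ s n, ⟨_, memOrlicz_indicator_one h (hB i)⟩)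
      (ξ₀ := ⟨_, memOrlicz_indicator_one h hU⟩) hone (fun n ω => ?_) (fun ω => ?_)
    · simp only [map_sum] at this
      exact this
    · rw [hsum]
      by_cases hω : ω ∈ ⋃ i ∈ s n, B i
      · rw [indicator_of_mem hω, abs_one]
      · rw [indicator_of_notMem hω, abs_zero]; exact zero_le_one
    · simp only [hsum]
      refine tendsto_const_nhds.congr' ?_
      by_cases hω : ω ∈ ⋃ i, B i
      · obtain ⟨i, hi⟩ := mem_iUnion.1 hω
        filter_upwards [hs.eventually (eventually_ge_atTop {i})] with n hn
        have hω' : ω ∈ ⋃ i ∈ s n, B i := mem_biUnion (hn (Finset.mem_singleton_self i)) hi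
        rw [indicator_of_mem hω, indicator_of_mem hω']
      · refine Eventually.of_forall fun n => ?_
        have hω' : ω ∉ ⋃ i ∈ s n, B i := fun hc => hω (iUnion₂_subset_iUnion _ _ hc)
        simp only [indicator_of_notMem hω, indicator_of_notMem hω']

lemma OrderContinuousFunctional.signedMeasure_apply (hL : OrderContinuousFunctional h L)
    {B : Set Ω} (hB : MeasurableSet B) :
    hL.signedMeasure B = L ⟨_, memOrlicz_indicator_one h hB⟩ := dif_pos hB

/-- The density of an order continuous functional. -/
def OrderContinuousFunctional.density (hL : OrderContinuousFunctional h L) : Ω → ℝ :=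
  hL.signedMeasure.rnDeriv P

lemma OrderContinuousFunctional.measurable_density (hL : OrderContinuousFunctional h L) :
    Measurable hL.density := SignedMeasure.measurable_rnDeriv _ _

lemma OrderContinuousFunctional.integrable_density (hL : OrderContinuousFunctional h L) :
    Integrable hL.density P := SignedMeasure.integrable_rnDeriv _ _

lemma OrderContinuousFunctional.map_indicator (hL : OrderContinuousFunctional h L)
    {B : Set Ω} (hB : MeasurableSet B) :
    L ⟨_, memOrlicz_indicator_one h hB⟩ = ∫ ω in B, hL.density ω ∂P := by
  have hac : hL.signedMeasure ≪ᵥ P.toENNRealVectorMeasure := by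
    refine VectorMeasure.AbsolutelyContinuous.mk fun B hB hPB => ?_
    rw [Measure.toENNRealVectorMeasure_apply_measurable hB] at hPB
    rw [hL.signedMeasure_apply hB]
    refine hL.map_eq_zero ?_
    filter_upwards [measure_eq_zero_iff_ae_notMem.1 hPB] with ω hω
    exact indicator_of_notMem hω _
  rw [← hL.signedMeasure_apply hB, ← withDensityᵥ_apply hL.integrable_density hB]
  exact congrArg (fun m : SignedMeasure Ω => m B)
    (SignedMeasure.withDensityᵥ_rnDeriv_eq _ P hac).symm

lemma OrderContinuousFunctional.map_simpleFunc (hL : OrderContinuousFunctional h L)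
    (s : SimpleFunc Ω ℝ) : ∀ hs : MemOrlicz P Φ s, L ⟨s, hs⟩ = ∫ ω, hL.density ω * s ω ∂P := by
  have hb : ∀ t : SimpleFunc Ω ℝ, ∃ C, ∀ ω, |t ω| ≤ C := fun t =>
    t.exists_forall_norm_le
  have hi : ∀ t : SimpleFunc Ω ℝ, Integrable (fun ω => hL.density ω * t ω) P := fun t => by
    obtain ⟨C, hC⟩ := hb t
    exact hL.integrable_density.mul_bdd t.measurable.aestronglyMeasurable
      (ae_of_all _ hC)
  induction s using SimpleFunc.induction with
  | const c hB =>
    rename_i B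
    intro hs
    have e : (⟨_, hs⟩ : orliczSubmodule (P := P) h) = c • ⟨_, memOrlicz_indicator_one h hB⟩ := by
      refine Subtype.ext (funext fun ω => ?_)
      by_cases hω : ω ∈ B <;> simp [hω]
    rw [e, map_smul, hL.map_indicator hB, smul_eq_mul, ← integral_const_mul,
      ← integral_indicator hB]
    refine integral_congr_ae (ae_of_all _ fun ω => ?_)
    by_cases hω : ω ∈ B <;> simp [hω, mul_comm]
  | add _ iha ihb =>
    rename_i s t _
    intro hs
    obtain ⟨C, hC⟩ := hb s
    obtain ⟨D, hD⟩ := hb t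
    have hms : MemOrlicz P Φ s := MemOrlicz.of_bounded h s.measurable hC
    have hmt : MemOrlicz P Φ t := MemOrlicz.of_bounded h t.measurable hD
    have e : (⟨_, hs⟩ : orliczSubmodule (P := P) h) = ⟨s, hms⟩ + ⟨t, hmt⟩ := rfl
    rw [e, map_add, iha hms, ihb hmt, ← integral_add (hi s) (hi t)]
    simp only [SimpleFunc.coe_add, Pi.add_apply, mul_add]

lemma OrderContinuousFunctional.map_of_bounded (hL : OrderContinuousFunctional h L)
    (g : orliczSubmodule (P := P) h) {C : ℝ} (hC : ∀ ω, |g.1 ω| ≤ C) :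
    L g = ∫ ω, hL.density ω * g.1 ω ∂P := by
  have hgm : StronglyMeasurable g.1 := g.2.1.stronglyMeasurable
  have hC0 : 0 ≤ max C 0 := le_max_right _ _
  have hs : ∀ n ω, |hgm.approxBounded (max C 0) n ω| ≤ max C 0 := fun n ω =>
    hgm.norm_approxBounded_le hC0 n ω
  have hmem : ∀ n, MemOrlicz P Φ (hgm.approxBounded (max C 0) n) := fun n =>
    MemOrlicz.of_bounded h (SimpleFunc.measurable _) (hs n)
  have hlim : ∀ ω, Tendsto (fun n => hgm.approxBounded (max C 0) n ω) atTop (𝓝 (g.1 ω)) :=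
    fun ω => hgm.tendsto_approxBounded_of_norm_le ((hC ω).trans (le_max_left _ _))
  have h1 := hL.tendsto (ξ := fun n => ⟨_, hmem n⟩) (ξ₀ := g)
    (MemOrlicz.of_bounded h measurable_const (C := max C 0) fun _ => (abs_of_nonneg hC0).le) hs hlim
  have h2 : Tendsto (fun n => ∫ ω, hL.density ω * hgm.approxBounded (max C 0) n ω ∂P) atTop
      (𝓝 (∫ ω, hL.density ω * g.1 ω ∂P)) := by
    refine tendsto_integral_of_dominated_convergence (fun ω => |hL.density ω| * max C 0)
      (fun n => (hL.measurable_density.mul (SimpleFunc.measurable _)).aestronglyMeasurable)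
      (hL.integrable_density.abs.mul_const _) (fun n => ae_of_all _ fun ω => ?_)
      (ae_of_all _ fun ω => (hlim ω).const_mul _)
    rw [Real.norm_eq_abs, abs_mul]
    exact mul_le_mul_of_nonneg_left (hs n ω) (abs_nonneg _)
  simp only [hL.map_simpleFunc] at h1
  exact tendsto_nhds_unique h1 h2

end OrderDual

section ConjugateDual

variable {Ω : Type*} [MeasurableSpace Ω] {P : Measure Ω} [IsFiniteMeasure P] {Φ : ℝ → ℝ}

lemma OrderContinuousFunctional.memOrlicz_density (h : IsYoung Φ)
    {L : orliczSubmodule (P := P) h.conj →ₗ[ℝ] ℝ} (hL : OrderContinuousFunctional h.conj L) :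
    MemOrlicz P Φ hL.density := by
  refine ⟨hL.measurable_density, ?_⟩
  by_contra! hcon
  have hex : ∀ n : ℕ, ∃ g : Ω → ℝ, Measurable g ∧ (∃ C, ∀ ω, |g ω| ≤ C) ∧
      ∫⁻ ω, ENNReal.ofReal (OrliczPaper.conj Φ (g ω)) ∂P ≤ 1 ∧
      1 ≤ ∫ ω, ((1 / 4 : ℝ) ^ n * hL.density ω) * g ω ∂P := fun n =>
    h.exists_one_le_integral_mul (hL.measurable_density.const_mul _)
      (top_le_iff.1 (hcon _ (by positivity)))
  choose g hgm hgb hg1 hg2 using hex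
  choose C hC using hgb
  have hmem : ∀ n, MemOrlicz P (conj Φ) (g n) := fun n => MemOrlicz.of_bounded h.conj (hgm n) (hC n)
  have hlim := hL (fun n => (1 / 4 : ℝ) ^ n • ⟨g n, hmem n⟩)
    (h.conj.orderNull_of_lintegral_le_one hgm hg1)
  have hge : ∀ n, 1 ≤ L ((1 / 4 : ℝ) ^ n • ⟨g n, hmem n⟩) := fun n => by
    rw [map_smul, hL.map_of_bounded _ (hC n), smul_eq_mul, ← integral_const_mul]
    simpa only [mul_assoc] using hg2 n
  exact absurd (ge_of_tendsto' hlim hge) (by norm_num)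

/-- Order continuous functionals on `L_{Φ*}` are represented by elements of `L_Φ`. -/
lemma OrderContinuousFunctional.eq_pairing_density (h : IsYoung Φ)
    {L : orliczSubmodule (P := P) h.conj →ₗ[ℝ] ℝ} (hL : OrderContinuousFunctional h.conj L)
    (ξ : orliczSubmodule (P := P) h.conj) : L ξ = pairing P hL.density ξ.1 := by
  let T : ℕ → Set Ω := fun m => {ω | |ξ.1 ω| ≤ m}
  have hT : ∀ m, MeasurableSet (T m) := fun m => measurableSet_le ξ.2.1.abs measurable_const
  have hle : ∀ n ω, |(T n).indicator ξ.1 ω| ≤ |ξ.1 ω| := fun n ω => by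
    by_cases hω : ω ∈ T n <;> simp [hω]
  have hmem : ∀ n, MemOrlicz P (conj Φ) ((T n).indicator ξ.1) := fun n =>
    MemOrlicz.of_abs_le h.conj ξ.2 (ξ.2.1.indicator (hT n)) (ae_of_all _ (hle n))
  have habs : MemOrlicz P (conj Φ) fun ω => |ξ.1 ω| :=
    MemOrlicz.of_abs_le h.conj ξ.2 ξ.2.1.abs (ae_of_all _ fun ω => (abs_abs _).le)
  have hlim : ∀ ω, Tendsto (fun n => (T n).indicator ξ.1 ω) atTop (𝓝 (ξ.1 ω)) := fun ω => by
    refine tendsto_const_nhds.congr' ?_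
    filter_upwards [eventually_ge_atTop ⌈|ξ.1 ω|⌉₊] with m hm
    have hω : ω ∈ T m := Nat.ceil_le.1 hm
    rw [indicator_of_mem hω]
  have h1 := hL.tendsto (ξ := fun n => ⟨_, hmem n⟩) (ξ₀ := ξ) habs hle hlim
  have h2 : Tendsto (fun n => ∫ ω, hL.density ω * (T n).indicator ξ.1 ω ∂P) atTop
      (𝓝 (∫ ω, hL.density ω * ξ.1 ω ∂P)) := by
    refine tendsto_integral_of_dominated_convergence (fun ω => |hL.density ω * ξ.1 ω|)
      (fun n => (hL.measurable_density.mul (ξ.2.1.indicator (hT n))).aestronglyMeasurable)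
      (MemOrlicz.integrable_mul h (hL.memOrlicz_density h) ξ.2).abs (fun n => ae_of_all _ fun ω => ?_)
      (ae_of_all _ fun ω => (hlim ω).const_mul _)
    rw [Real.norm_eq_abs, abs_mul, abs_mul]
    exact mul_le_mul_of_nonneg_left (hle n ω) (abs_nonneg _)
  refine tendsto_nhds_unique h1 (h2.congr fun n => ?_)
  refine (hL.map_of_bounded ⟨_, hmem n⟩ (C := n) fun ω => ?_).symm
  by_cases hω : ω ∈ T n
  · simpa [hω] using (show |ξ.1 ω| ≤ n from hω)
  · simp [hω]

end ConjugateDual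

section Seminorms

/-- A seminorm is attained at any given vector by a linear functional it dominates. -/
lemma exists_linearMap_eq_seminorm {E : Type*} [AddCommGroup E] [Module ℝ E] (p : Seminorm ℝ E)
    (x : E) : ∃ L : E →ₗ[ℝ] ℝ, (∀ y, |L y| ≤ p y) ∧ L x = p x := by
  by_cases hx : x = 0
  · exact ⟨0, fun y => by simp, by simp [hx]⟩
  obtain ⟨L, hLx, hL⟩ := exists_extension_of_le_sublinear
    (LinearPMap.mkSpanSingleton (K := ℝ) x (p x) hx) p
    (fun c hc y => by rw [map_smul_eq_mul, Real.norm_of_nonneg hc.le]) (map_add_le_add p)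
    (fun ⟨y, hy⟩ => by
      obtain ⟨c, rfl⟩ := Submodule.mem_span_singleton.1 hy
      refine (LinearPMap.mkSpanSingleton'_apply x (p x) _ c hy).trans_le ?_
      rw [map_smul_eq_mul, smul_eq_mul]
      exact mul_le_mul_of_nonneg_right (le_abs_self c) (apply_nonneg p x))
  refine ⟨L, fun y => abs_le.2 ⟨?_, hL y⟩, ?_⟩
  · have := hL (-y)
    rw [map_neg, map_neg_eq_map] at this
    linarith
  · have h1 := hLx ⟨x, Submodule.mem_span_singleton_self x⟩
    exact h1.trans (LinearPMap.mkSpanSingleton_apply ℝ ℝ hx (p x))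

/-- A convex function on a real vector space is controlled near the origin by the gauge of a
symmetric sublevel set. -/
lemma exists_seminorm_of_convexOn {E : Type*} [AddCommGroup E] [Module ℝ E] {g : E → ℝ}
    (hg : ConvexOn ℝ univ g) {ε : ℝ} (hε : 0 < ε) :
    ∃ p : Seminorm ℝ E, (∀ x, p x < 1 → |g x - g 0| ≤ ε) ∧
      ∀ x, |g x - g 0| ≤ ε → |g (-x) - g 0| ≤ ε → p x ≤ 1 := by
  set V : Set E := {x | g x ≤ g 0 + ε ∧ g (-x) ≤ g 0 + ε} with hV
  have hV0 : (0 : E) ∈ V := by simp [hV, hε.le]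
  have hconv : Convex ℝ V := by
    rintro x ⟨hx, hx'⟩ y ⟨hy, hy'⟩ a b ha hb hab
    have h1 := hg.2 (mem_univ x) (mem_univ y) ha hb hab
    have h2 := hg.2 (mem_univ (-x)) (mem_univ (-y)) ha hb hab
    have e : -(a • x + b • y) = a • -x + b • -y := by module
    simp only [smul_eq_mul] at h1 h2
    have hb' : b = 1 - a := by linarith
    refine ⟨?_, ?_⟩
    · subst hb'; nlinarith
    · rw [e]; subst hb'; nlinarith
  have hsymm : ∀ x ∈ V, -x ∈ V := fun x hx => ⟨hx.2, by simpa using hx.1⟩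
  have hbal : Balanced ℝ V := by
    refine balanced_iff_smul_mem.2 fun {a} ha {x} hx => ?_
    rw [Real.norm_eq_abs] at ha
    have key : ∀ y ∈ V, |a| • y ∈ V := fun y hy =>
      hconv.smul_mem_of_zero_mem hV0 hy ⟨abs_nonneg a, ha⟩
    rcases abs_choice a with h | h
    · simpa [h] using key x hx
    · simpa [h] using key (-x) (hsymm x hx)
  have hcont : ∀ x : E, Continuous fun c : ℝ => g (c • x) := fun x => by
    have hc : ConvexOn ℝ univ fun c : ℝ => g (c • x) :=
      hg.comp_linearMap ((LinearMap.id : ℝ →ₗ[ℝ] ℝ).smulRight x)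
    exact continuousOn_univ.1 (hc.continuousOn isOpen_univ)
  have hev : ∀ x : E, ∀ᶠ c : ℝ in 𝓝 0, g (c • x) < g 0 + ε := fun x =>
    (hcont x).continuousAt.eventually_lt continuousAt_const (by simpa using hε)
  have habs : Absorbent ℝ V := by
    refine absorbent_iff_eventually_nhdsNE_zero.2 fun x => ?_
    filter_upwards [nhdsWithin_le_nhds (hev x), nhdsWithin_le_nhds (hev (-x))] with c h1 h2
    exact ⟨h1.le, by rw [← smul_neg]; exact h2.le⟩
  refine ⟨gaugeSeminorm hbal hconv habs, fun x hx => ?_, fun x h1 h2 => ?_⟩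
  · have hxV : x ∈ V := setOfPred_gauge_lt_one_subset_self hconv hV0 habs hx
    have hmid := hg.2 (mem_univ x) (mem_univ (-x)) (show (0 : ℝ) ≤ 1 / 2 by norm_num)
      (show (0 : ℝ) ≤ 1 / 2 by norm_num) (by norm_num)
    have e : (1 / 2 : ℝ) • x + (1 / 2 : ℝ) • -x = 0 := by module
    rw [e] at hmid
    simp only [smul_eq_mul] at hmid
    have h1 := hxV.1
    have h2 := hxV.2
    exact abs_le.2 ⟨by linarith, by linarith⟩
  · exact gauge_le_one_of_mem ⟨by linarith [(abs_le.1 h1).2], by linarith [(abs_le.1 h2).2]⟩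

end Seminorms

section Mackey

variable {Ω : Type*} [MeasurableSpace Ω] {P : Measure Ω} {Φ : ℝ → ℝ}

lemma OrderNull.const_smul (h : IsYoung Φ) {ξ : ℕ → Ω → ℝ} (hξ : OrderNull P Φ ξ) (c : ℝ) :
    OrderNull P Φ fun n => c • ξ n := by
  obtain ⟨ζ, hζ, hle, hlim⟩ := hξ
  refine ⟨|c| • ζ, MemOrlicz.const_smul h hζ _, fun n => ?_, ?_⟩
  · filter_upwards [hle n] with ω hω
    simpa [abs_mul] using mul_le_mul_of_nonneg_left hω (abs_nonneg c)
  · filter_upwards [hlim] with ω hω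
    simpa using hω.const_mul c

variable [IsFiniteMeasure P]

/-- A seminorm is order continuous if it maps order null sequences to null sequences. -/
def OrderContinuousSeminorm (h : IsYoung Φ) (p : Seminorm ℝ (orliczSubmodule (P := P) h)) : Prop :=
  ∀ ξ : ℕ → orliczSubmodule (P := P) h, OrderNull P Φ (fun n => (ξ n).1) →
    Tendsto (fun n => p (ξ n)) atTop (𝓝 0)

/-- The polar in `L_Φ` of the unit ball of a seminorm on `L_{Φ*}`. -/
def seminormPolar (h : IsYoung Φ) (p : Seminorm ℝ (orliczSubmodule (P := P) h.conj)) :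
    Set (Orlicz P Φ) :=
  {η | ∀ ξ : orliczSubmodule (P := P) h.conj, |pairing P η.1 ξ.1| ≤ p ξ}

variable (h : IsYoung Φ) {p : Seminorm ℝ (orliczSubmodule (P := P) h.conj)}

lemma exists_mem_seminormPolar (hp : OrderContinuousSeminorm h.conj p)
    {L : orliczSubmodule (P := P) h.conj →ₗ[ℝ] ℝ} (hL : ∀ ξ, |L ξ| ≤ p ξ) :
    ∃ η ∈ seminormPolar h p, ∀ ξ, pairing P η.1 ξ.1 = L ξ := by
  have hLo : OrderContinuousFunctional h.conj L := fun ξ hξ =>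
    squeeze_zero_norm (fun n => hL (ξ n)) (hp ξ hξ)
  refine ⟨⟨hLo.density, hLo.memOrlicz_density h⟩, fun ξ => ?_, fun ξ => ?_⟩
  · rw [← hLo.eq_pairing_density h]
    exact hL ξ
  · rw [← hLo.eq_pairing_density h]

lemma seminormPolar_mem_dualSets (hp : OrderContinuousSeminorm h.conj p) :
    seminormPolar h p ∈ dualSets P (Orlicz P (conj Φ)) (Orlicz P Φ) := by
  have hsmul : ∀ (c : ℝ) (η : Ω → ℝ) (ξ : Ω → ℝ), pairing P (c • η) ξ = c * pairing P η ξ := by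
    intro c η ξ
    simp only [pairing, Pi.smul_apply, smul_eq_mul, mul_assoc, integral_const_mul]
  refine ⟨?_, ?_, ?_⟩
  · rintro _ ⟨η, hη, rfl⟩ _ ⟨η', hη', rfl⟩ a b ha hb hab
    have hm : MemOrlicz P Φ (a • η.1 + b • η'.1) :=
      MemOrlicz.add h (MemOrlicz.const_smul h η.2 a) (MemOrlicz.const_smul h η'.2 b)
    refine ⟨⟨_, hm⟩, fun ξ => ?_, rfl⟩
    have e : pairing P (a • η.1 + b • η'.1) ξ.1 = a * pairing P η.1 ξ.1 + b * pairing P η'.1 ξ.1 := by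
      rw [← hsmul, ← hsmul]
      unfold pairing
      rw [← integral_add (MemOrlicz.integrable_mul h (MemOrlicz.const_smul h η.2 a) ξ.2)
        (MemOrlicz.integrable_mul h (MemOrlicz.const_smul h η'.2 b) ξ.2)]
      simp only [Pi.add_apply, add_mul]
    change |pairing P (a • η.1 + b • η'.1) ξ.1| ≤ p ξ
    rw [e]
    refine (abs_add_le _ _).trans ?_
    rw [abs_mul, abs_mul, abs_of_nonneg ha, abs_of_nonneg hb]
    calc _ ≤ a * p ξ + b * p ξ := add_le_add (mul_le_mul_of_nonneg_left (hη ξ) ha)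
          (mul_le_mul_of_nonneg_left (hη' ξ) hb)
      _ = p ξ := by rw [← add_mul, hab, one_mul]
  · refine balanced_iff_smul_mem.2 ?_
    rintro a ha _ ⟨η, hη, rfl⟩
    refine ⟨⟨_, MemOrlicz.const_smul h η.2 a⟩, fun ξ => ?_, rfl⟩
    change |pairing P (a • η.1) ξ.1| ≤ p ξ
    rw [hsmul, abs_mul]
    exact (mul_le_of_le_one_left (abs_nonneg _) ha).trans (hη ξ)
  · let : TopologicalSpace (Orlicz P Φ) := weakT P (Orlicz P Φ) (Orlicz P (conj Φ))
    let F : Orlicz P Φ → orliczSubmodule (P := P) h.conj → ℝ := fun η ξ => pairing P η.1 ξ.1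
    have hF : IsInducing F := ⟨rfl⟩
    rw [hF.isCompact_iff]
    have himg : F '' seminormPolar h p =
        {φ | ∃ L : orliczSubmodule (P := P) h.conj →ₗ[ℝ] ℝ, ⇑L = φ} ∩
          Set.pi univ fun ξ => Icc (-p ξ) (p ξ) := by
      ext φ
      constructor
      · rintro ⟨η, hη, rfl⟩
        refine ⟨⟨⟨⟨fun ξ => pairing P η.1 ξ.1, fun ξ ξ' => ?_⟩, fun c ξ => ?_⟩, rfl⟩,
          fun ξ _ => abs_le.1 (hη ξ)⟩
        · unfold pairing
          rw [← integral_add (MemOrlicz.integrable_mul h η.2 ξ.2)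
            (MemOrlicz.integrable_mul h η.2 ξ'.2)]
          simp only [Submodule.coe_add, Pi.add_apply, mul_add]
        · change pairing P η.1 (c • ξ.1) = c * pairing P η.1 ξ.1
          rw [pairing_comm, hsmul, pairing_comm]
      · rintro ⟨⟨L, rfl⟩, hL⟩
        obtain ⟨η, hη, hηL⟩ := exists_mem_seminormPolar h hp fun ξ =>
          abs_le.2 (hL ξ (mem_univ ξ))
        exact ⟨η, hη, funext hηL⟩
    rw [himg]
    exact (isCompact_univ_pi fun ξ => isCompact_Icc).inter_left (LinearMap.isClosed_range_coe _ _ _)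

/-- Order continuous seminorms on `L_{Φ*}` are Mackey continuous. -/
lemma eventually_seminorm_sub_lt (hp : OrderContinuousSeminorm h.conj p)
    (ξ₀ : orliczSubmodule (P := P) h.conj) {r : ℝ} (hr : 0 < r) :
    ∀ᶠ ξ : orliczSubmodule (P := P) h.conj in
      @nhds _ (mackeyT P (Orlicz P (conj Φ)) (Orlicz P Φ)) ξ₀, p (ξ - ξ₀) < r := by
  have hid : Tendsto id (@nhds _ (mackeyT P (Orlicz P (conj Φ)) (Orlicz P Φ)) ξ₀)
    (@nhds _ (mackeyT P (Orlicz P (conj Φ)) (Orlicz P Φ)) ξ₀) := tendsto_id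
  filter_upwards [tendsto_mackeyT_iff.1 hid _ (seminormPolar_mem_dualSets h hp) r hr] with ξ hξ
  obtain ⟨L, hL, hLx⟩ := exists_linearMap_eq_seminorm p (ξ - ξ₀)
  obtain ⟨η, hη, hηL⟩ := exists_mem_seminormPolar h hp hL
  have h1 := hξ η hη
  rw [← hLx, map_sub, ← hηL, ← hηL, pairing_comm _ ξ.1, pairing_comm _ ξ₀.1]
  exact (abs_lt.1 ((abs_sub_comm _ _).trans_lt h1)).2

/-- A convex function on `L_{Φ*}` that is order continuous at a point is Mackey continuous there. -/
lemma tendsto_mackeyT_of_convexOn {g : orliczSubmodule (P := P) h.conj → ℝ}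
    (hg : ConvexOn ℝ univ g) (ξ₀ : orliczSubmodule (P := P) h.conj)
    (hord : ∀ ξ : ℕ → orliczSubmodule (P := P) h.conj, OrderNull P (conj Φ) (fun n => (ξ n).1) →
      Tendsto (fun n => g (ξ₀ + ξ n)) atTop (𝓝 (g ξ₀))) :
    Tendsto g (@nhds _ (mackeyT P (Orlicz P (conj Φ)) (Orlicz P Φ)) ξ₀) (𝓝 (g ξ₀)) := by
  rw [Metric.tendsto_nhds]
  intro ε hε
  have hg' : ConvexOn ℝ univ fun ξ => g (ξ₀ + ξ) := by
    exact hg.translate_right ξ₀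
  obtain ⟨p, hp, hp'⟩ := exists_seminorm_of_convexOn hg' (half_pos hε)
  simp only [add_zero] at hp hp'
  have hpo : OrderContinuousSeminorm h.conj p := by
    intro ξ hξ
    rw [Metric.tendsto_nhds]
    intro δ hδ
    have hlim : ∀ c : ℝ, ∀ᶠ n in atTop, |g (ξ₀ + c • ξ n) - g ξ₀| ≤ ε / 2 := fun c => by
      filter_upwards [Metric.tendsto_nhds.1 (hord (fun n => c • ξ n) (hξ.const_smul h.conj c)) _
        (half_pos hε)] with n hn
      exact (Real.dist_eq _ _ ▸ hn).le
    filter_upwards [hlim (2 / δ), hlim (-(2 / δ))] with n h1 h2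
    have h3 := hp' ((2 / δ) • ξ n) h1 ((neg_smul (2 / δ) (ξ n)) ▸ h2)
    rw [map_smul_eq_mul, Real.norm_of_nonneg (by positivity), div_mul_eq_mul_div,
      div_le_one hδ] at h3
    rw [Real.dist_eq, sub_zero, abs_of_nonneg (apply_nonneg p _)]
    linarith [apply_nonneg p (ξ n)]
  filter_upwards [eventually_seminorm_sub_lt h hpo ξ₀ one_pos] with ξ hξ
  have := hp _ hξ
  rw [add_sub_cancel] at this
  rw [Real.dist_eq]
  linarith

end Mackey

section OrderBounded

variable {Ω : Type*} [MeasurableSpace Ω] {P : Measure Ω} {Φ : ℝ → ℝ}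

lemma supMem_of_abs_le (h : IsYoung Φ) {ξ : ℕ → Ω → ℝ} (hξ : ∀ n, Measurable (ξ n)) {ζ : Ω → ℝ}
    (hζ : MemOrlicz P Φ ζ) (hle : ∀ n, ∀ᵐ ω ∂P, |ξ n ω| ≤ ζ ω) : supMem P Φ ξ := by
  have hle' := ae_all_iff.2 hle
  refine ⟨hle'.mono fun ω hω => ⟨ζ ω, by rintro _ ⟨n, rfl⟩; exact hω n⟩, ?_⟩
  refine MemOrlicz.of_abs_le h hζ (Measurable.iSup fun n => (hξ n).abs) ?_
  filter_upwards [hle'] with ω hω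
  rw [abs_of_nonneg (Real.iSup_nonneg fun n => abs_nonneg _)]
  exact (ciSup_le hω).trans (le_abs_self _)

lemma supMem.abs_le_iSup {ξ : ℕ → Ω → ℝ} (hξ : supMem P Φ ξ) :
    ∀ᵐ ω ∂P, ∀ n, |ξ n ω| ≤ ⨆ k, |ξ k ω| :=
  hξ.1.mono fun _ hω n => le_ciSup hω n

end OrderBounded

/-- If `Φ ∈ Δ₂` and `f : L_{Φ*} → ℝ` is a finite convex
function, the following are equivalent: (1) Mackey continuity; (2) sequential
Mackey continuity; (3) sequential Mackey continuity on closed balls;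
(4) sequential Mackey continuity on order intervals; (5) order continuity. -/
theorem statement17
    {Ω : Type*} [MeasurableSpace Ω] (P : Measure Ω) [IsProbabilityMeasure P]
    (Φ : ℝ → ℝ) (hΦ : IsYoung Φ) (hΔ : Delta2 Φ)
    (f : (Ω → ℝ) → ℝ)
    (hconvex : ∀ ξ ∈ Orlicz P (conj Φ), ∀ η ∈ Orlicz P (conj Φ), ∀ a b : ℝ,
      0 ≤ a → 0 ≤ b → a + b = 1 →
      f (a • ξ + b • η) ≤ a * f ξ + b * f η) :
    -- (1) ↔ (2)
    ((@Continuous _ _ (mackeyT P (Orlicz P (conj Φ)) (Orlicz P Φ)) _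
        fun ξ : Orlicz P (conj Φ) => f ξ.1) ↔
      (∀ (ξ : ℕ → Orlicz P (conj Φ)) (ξ₀ : Orlicz P (conj Φ)),
        Tendsto ξ atTop (@nhds _ (mackeyT P (Orlicz P (conj Φ)) (Orlicz P Φ)) ξ₀) →
        Tendsto (fun n => f (ξ n).1) atTop (𝓝 (f ξ₀.1)))) ∧
    -- (1) ↔ (3): sequential Mackey continuity on closed balls λ·B_{Φ*}
    ((@Continuous _ _ (mackeyT P (Orlicz P (conj Φ)) (Orlicz P Φ)) _
        fun ξ : Orlicz P (conj Φ) => f ξ.1) ↔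
      (∀ lam : ℝ, 0 < lam →
        ∀ (ξ : ℕ → Orlicz P (conj Φ)) (ξ₀ : Orlicz P (conj Φ)),
          (∀ n, ∫⁻ ω, ENNReal.ofReal (conj Φ ((ξ n).1 ω / lam)) ∂P ≤ 1) →
          (∫⁻ ω, ENNReal.ofReal (conj Φ (ξ₀.1 ω / lam)) ∂P ≤ 1) →
          Tendsto ξ atTop (@nhds _ (mackeyT P (Orlicz P (conj Φ)) (Orlicz P Φ)) ξ₀) →
          Tendsto (fun n => f (ξ n).1) atTop (𝓝 (f ξ₀.1)))) ∧
    -- (1) ↔ (4): sequential Mackey continuity on order intervals [-ζ,ζ]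
    ((@Continuous _ _ (mackeyT P (Orlicz P (conj Φ)) (Orlicz P Φ)) _
        fun ξ : Orlicz P (conj Φ) => f ξ.1) ↔
      (∀ ζ : Ω → ℝ, ζ ∈ Orlicz P (conj Φ) → 0 ≤ᵐ[P] ζ →
        ∀ (ξ : ℕ → Orlicz P (conj Φ)) (ξ₀ : Orlicz P (conj Φ)),
          (∀ n, ∀ᵐ ω ∂P, |(ξ n).1 ω| ≤ ζ ω) →
          (∀ᵐ ω ∂P, |ξ₀.1 ω| ≤ ζ ω) →
          Tendsto ξ atTop (@nhds _ (mackeyT P (Orlicz P (conj Φ)) (Orlicz P Φ)) ξ₀) →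
          Tendsto (fun n => f (ξ n).1) atTop (𝓝 (f ξ₀.1)))) ∧
    -- (1) ↔ (5): order continuity
    ((@Continuous _ _ (mackeyT P (Orlicz P (conj Φ)) (Orlicz P Φ)) _
        fun ξ : Orlicz P (conj Φ) => f ξ.1) ↔
      (∀ ξ : ℕ → Ω → ℝ, (∀ n, ξ n ∈ Orlicz P (conj Φ)) →
        supMem P (conj Φ) ξ →
        ∀ ξ₀ ∈ Orlicz P (conj Φ),
          (∀ᵐ ω ∂P, Tendsto (fun n => ξ n ω) atTop (𝓝 (ξ₀ ω))) →
          Tendsto (fun n => f (ξ n)) atTop (𝓝 (f ξ₀)))) := by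
  set E := Orlicz P (conj Φ) with hE
  have h12 : (@Continuous _ _ (mackeyT P E (Orlicz P Φ)) _ fun ξ : E => f ξ.1) →
      ∀ (ξ : ℕ → E) (ξ₀ : E), Tendsto ξ atTop (@nhds _ (mackeyT P E (Orlicz P Φ)) ξ₀) →
        Tendsto (fun n => f (ξ n).1) atTop (𝓝 (f ξ₀.1)) := fun hc ξ ξ₀ hξ =>
    (@Continuous.tendsto _ _ (mackeyT P E (Orlicz P Φ)) _ _ hc ξ₀).comp hξ
  have h34 : (∀ lam : ℝ, 0 < lam → ∀ (ξ : ℕ → E) (ξ₀ : E),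
          (∀ n, ∫⁻ ω, ENNReal.ofReal (conj Φ ((ξ n).1 ω / lam)) ∂P ≤ 1) →
          (∫⁻ ω, ENNReal.ofReal (conj Φ (ξ₀.1 ω / lam)) ∂P ≤ 1) →
          Tendsto ξ atTop (@nhds _ (mackeyT P E (Orlicz P Φ)) ξ₀) →
          Tendsto (fun n => f (ξ n).1) atTop (𝓝 (f ξ₀.1))) →
      ∀ ζ : Ω → ℝ, ζ ∈ E → 0 ≤ᵐ[P] ζ → ∀ (ξ : ℕ → E) (ξ₀ : E),
          (∀ n, ∀ᵐ ω ∂P, |(ξ n).1 ω| ≤ ζ ω) → (∀ᵐ ω ∂P, |ξ₀.1 ω| ≤ ζ ω) →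
          Tendsto ξ atTop (@nhds _ (mackeyT P E (Orlicz P Φ)) ξ₀) →
          Tendsto (fun n => f (ξ n).1) atTop (𝓝 (f ξ₀.1)) := by
    intro h3 ζ hζ _ ξ ξ₀ hξ hξ₀ hlim
    obtain ⟨r, hr, hr1⟩ := MemOrlicz.exists_lintegral_div_le_one hΦ.conj hζ
    have hball : ∀ u : Ω → ℝ, (∀ᵐ ω ∂P, |u ω| ≤ ζ ω) →
        ∫⁻ ω, ENNReal.ofReal (conj Φ (u ω / r)) ∂P ≤ 1 := fun u hu => by
      refine (lintegral_mono_ae ?_).trans hr1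
      filter_upwards [hu] with ω hω
      refine ENNReal.ofReal_le_ofReal (hΦ.conj.mono ?_)
      rw [abs_div, abs_div]
      exact div_le_div_of_nonneg_right (hω.trans (le_abs_self _)) (abs_nonneg r)
    exact h3 r hr ξ ξ₀ (fun n => hball _ (hξ n)) (hball _ hξ₀) hlim
  have h45 : (∀ ζ : Ω → ℝ, ζ ∈ E → 0 ≤ᵐ[P] ζ → ∀ (ξ : ℕ → E) (ξ₀ : E),
          (∀ n, ∀ᵐ ω ∂P, |(ξ n).1 ω| ≤ ζ ω) → (∀ᵐ ω ∂P, |ξ₀.1 ω| ≤ ζ ω) →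
          Tendsto ξ atTop (@nhds _ (mackeyT P E (Orlicz P Φ)) ξ₀) →
          Tendsto (fun n => f (ξ n).1) atTop (𝓝 (f ξ₀.1))) →
      ∀ ξ : ℕ → Ω → ℝ, (∀ n, ξ n ∈ E) → supMem P (conj Φ) ξ → ∀ ξ₀ ∈ E,
          (∀ᵐ ω ∂P, Tendsto (fun n => ξ n ω) atTop (𝓝 (ξ₀ ω))) →
          Tendsto (fun n => f (ξ n)) atTop (𝓝 (f ξ₀)) := by
    intro h4 ξ hξ hsup ξ₀ hξ₀ hlim
    have hle := hsup.abs_le_iSup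
    refine h4 _ hsup.2 (ae_of_all _ fun ω => Real.iSup_nonneg fun n => abs_nonneg _)
      (fun n => ⟨ξ n, hξ n⟩) ⟨ξ₀, hξ₀⟩ (ae_all_iff.1 hle) ?_
      (tendsto_mackeyT_of_order hΦ hsup.2 (ae_all_iff.1 hle) hlim)
    filter_upwards [hle, hlim] with ω hω hω'
    exact le_of_tendsto hω'.abs (Eventually.of_forall hω)
  have h51 : (∀ ξ : ℕ → Ω → ℝ, (∀ n, ξ n ∈ E) → supMem P (conj Φ) ξ → ∀ ξ₀ ∈ E,
          (∀ᵐ ω ∂P, Tendsto (fun n => ξ n ω) atTop (𝓝 (ξ₀ ω))) →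
          Tendsto (fun n => f (ξ n)) atTop (𝓝 (f ξ₀))) →
      @Continuous _ _ (mackeyT P E (Orlicz P Φ)) _ fun ξ : E => f ξ.1 := by
    intro h5
    refine (@continuous_iff_continuousAt _ _ (mackeyT P E (Orlicz P Φ)) _ _).2 fun ξ₀ => ?_
    have hg : ConvexOn ℝ univ fun ξ : orliczSubmodule (P := P) hΦ.conj => f ξ.1 :=
      ⟨convex_univ, fun ξ _ η _ a b ha hb hab => hconvex _ ξ.2 _ η.2 a b ha hb hab⟩
    refine tendsto_mackeyT_of_convexOn hΦ hg ξ₀ fun ξ hξ => ?_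
    obtain ⟨ζ, hζ, hle, hlim⟩ := hξ
    have hζ' : MemOrlicz P (conj Φ) ((fun ω => |ξ₀.1 ω|) + ζ) :=
      MemOrlicz.add hΦ.conj (MemOrlicz.of_abs_le hΦ.conj ξ₀.2 ξ₀.2.1.abs
        (ae_of_all _ fun ω => (abs_abs _).le)) hζ
    have hmem : ∀ n, ξ₀.1 + (ξ n).1 ∈ E := fun n => MemOrlicz.add hΦ.conj ξ₀.2 (ξ n).2
    refine h5 (fun n => ξ₀.1 + (ξ n).1) hmem
      (supMem_of_abs_le hΦ.conj (fun n => (hmem n).1) hζ' fun n => ?_) ξ₀.1 ξ₀.2 ?_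
    · filter_upwards [hle n] with ω hω
      exact (abs_add_le _ _).trans (by simpa using hω)
    · filter_upwards [hlim] with ω hω
      simpa using hω.const_add (ξ₀.1 ω)
  refine ⟨⟨h12, fun h2 => h51 (h45 (h34 fun _ _ ξ ξ₀ _ _ => h2 ξ ξ₀))⟩,
    ⟨fun h1 _ _ ξ ξ₀ _ _ => h12 h1 ξ ξ₀, fun h3 => h51 (h45 (h34 h3))⟩,
    ⟨fun h1 _ _ _ ξ ξ₀ _ _ => h12 h1 ξ ξ₀, fun h4 => h51 (h45 h4)⟩,
    ⟨fun h1 => h45 fun _ _ _ ξ ξ₀ _ _ => h12 h1 ξ ξ₀, h51⟩⟩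

end OrliczPaper
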